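/- Assume hypothesis (H0), let W be a p₀-Minimum Restraint Function with p₀ ≥ 0, and let K be a W-feedback. Then there exists β ∈ KL such that for every R > 0 there exist δ(R) > 0 and a continuous, strictly increasing function r : [0,δ(R)] → [0,R] with r(0) = 0 and r(δ(R)) = R, such that: for every δ ∈ (0,δ(R)), every partition π of [0,∞) with diam(π) = δ, and every initial point z ∈ ℝⁿ ∖ C with d(z) ≤ R, any π-sampling trajectory-control pair (x,u) from z associated with K is defined on [0,∞) and satisfies d(x(t)) ≤ max{β(R,t), r(δ)} for all t ≥ 0; moreover, if p₀ > 0, then ∫₀^{T̄} l(x(τ),u(τ)) dτ ≤ W(z)/p₀, where T̄ := inf{t > 0 : d(x(τ)) ≤ r(δ) for all τ ≥ t}. -/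

import Mathlib

open Filter Topology Metric MeasureTheory Bornology
open scoped RealInnerProductSpace ENNReal NNReal

noncomputable section

abbrev Euc (n : ℕ) : Type := EuclideanSpace ℝ (Fin n)

/-- Distance to the target set. -/
def dC {n : ℕ} (C : Set (Euc n)) (y : Euc n) : ℝ := Metric.infDist y C

/-- The Hamiltonian `H(x, p₀, p) = inf_{u ∈ U} (⟪p, f(x,u)⟫ + p₀ l(x,u))`. -/
def Ham {n m : ℕ} (U : Set (Euc m)) (f : Euc n → Euc m → Euc n) (l : Euc n → Euc m → ℝ)
    (p0 : ℝ) (x p : Euc n) : ℝ :=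
  sInf ((fun u => ⟪p, f x u⟫ + p0 * l x u) '' U)

/-- The Hamiltonian truncated to controls of norm at most `N`. -/
def HamN {n m : ℕ} (U : Set (Euc m)) (f : Euc n → Euc m → Euc n) (l : Euc n → Euc m → ℝ)
    (N : ℝ) (p0 : ℝ) (x p : Euc n) : ℝ :=
  sInf ((fun u => ⟪p, f x u⟫ + p0 * l x u) '' (U ∩ Metric.closedBall 0 N))

/-- Set of limiting gradients `D*W(x)`. -/
def limitingGradients {n : ℕ} (W : Euc n → ℝ) (x : Euc n) : Set (Euc n) :=
  {w | ∃ xk : ℕ → Euc n, (∀ k, DifferentiableAt ℝ W (xk k) ∧ xk k ≠ x) ∧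
    Tendsto xk atTop (𝓝 x) ∧ Tendsto (fun k => gradient W (xk k)) atTop (𝓝 w)}

/-- Proximal subdifferential `∂_P W(x)`. -/
def proxSubdiff {n : ℕ} (W : Euc n → ℝ) (x : Euc n) : Set (Euc n) :=
  {p | ∃ σ > (0:ℝ), ∃ η > (0:ℝ), ∀ y, ‖y - x‖ ≤ η →
    ⟪p, y - x⟫ ≤ W y - W x + σ * ‖y - x‖ ^ 2}

/-- Limiting subdifferential `∂_L W(x)`. -/
def limitingSubdiff {n : ℕ} (W : Euc n → ℝ) (x : Euc n) : Set (Euc n) :=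
  {p | ∃ (xk : ℕ → Euc n) (pk : ℕ → Euc n), (∀ k, pk k ∈ proxSubdiff W (xk k)) ∧
    Tendsto xk atTop (𝓝 x) ∧ Tendsto pk atTop (𝓝 p)}

/-- `W` is positive definite on `ℝⁿ ∖ C`. -/
def PosDefOn {n : ℕ} (C : Set (Euc n)) (W : Euc n → ℝ) : Prop :=
  (∀ x, x ∉ C → 0 < W x) ∧ ∀ x ∈ frontier C, W x = 0

/-- `W` is proper on `ℝⁿ ∖ C`: preimages (within the closure of the complement of the
target) of compact subsets of `[0,∞)` are compact. -/
def ProperOn {n : ℕ} (C : Set (Euc n)) (W : Euc n → ℝ) : Prop :=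
  ∀ Kc : Set ℝ, IsCompact Kc → Kc ⊆ Set.Ici 0 → IsCompact (closure Cᶜ ∩ W ⁻¹' Kc)

/-- `W` is locally semiconcave on `ℝⁿ ∖ C`. -/
def LocSemiconcaveOn {n : ℕ} (C : Set (Euc n)) (W : Euc n → ℝ) : Prop :=
  ∀ S : Set (Euc n), IsCompact S → S ⊆ Cᶜ → ∃ ρ > (0:ℝ),
    ∀ x y : Euc n, segment ℝ x y ⊆ S →
      W x + W y - 2 * W (midpoint ℝ x y) ≤ ρ * ‖x - y‖ ^ 2

/-- `W` is locally Lipschitz continuous on the set `s`. -/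
def LocLipschitzOn {n : ℕ} (s : Set (Euc n)) (W : Euc n → ℝ) : Prop :=
  ∀ x ∈ s, ∃ (K : ℝ≥0) (t : Set (Euc n)), t ∈ nhdsWithin x s ∧ LipschitzOnWith K W t

/-- `γ : (0,∞) → (0,∞)` is a continuous, strictly increasing rate function. -/
def RateFun (γ : ℝ → ℝ) : Prop :=
  ContinuousOn γ (Set.Ioi 0) ∧ StrictMonoOn γ (Set.Ioi 0) ∧ ∀ r, 0 < r → 0 < γ r

/-- `W` is a `p₀`-Minimum Restraint Function with rate `γ`. -/
def IsMRF {n m : ℕ} (C : Set (Euc n)) (U : Set (Euc m)) (f : Euc n → Euc m → Euc n)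
    (l : Euc n → Euc m → ℝ) (p0 : ℝ) (W : Euc n → ℝ) (γ : ℝ → ℝ) : Prop :=
  ContinuousOn W (closure Cᶜ) ∧ (∀ x ∈ closure Cᶜ, 0 ≤ W x) ∧
  LocSemiconcaveOn C W ∧ PosDefOn C W ∧ ProperOn C W ∧ RateFun γ ∧
  ∀ x, x ∉ C → ∀ p ∈ limitingGradients W x, Ham U f l p0 x p ≤ -γ (W x)

/-- `W` is a `p₀`-OMRF (original Minimum Restraint Function of Motta-Rampazzo). -/
def IsOMRF {n m : ℕ} (C : Set (Euc n)) (U : Set (Euc m)) (f : Euc n → Euc m → Euc n)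
    (l : Euc n → Euc m → ℝ) (p0 : ℝ) (W : Euc n → ℝ) : Prop :=
  ContinuousOn W (closure Cᶜ) ∧ (∀ x ∈ closure Cᶜ, 0 ≤ W x) ∧
  LocSemiconcaveOn C W ∧ PosDefOn C W ∧ ProperOn C W ∧
  ∀ x, x ∉ C → ∀ p ∈ limitingGradients W x, Ham U f l p0 x p < 0

/-- Hypothesis (H0). -/
def HypH0 {n m : ℕ} (C : Set (Euc n)) (U : Set (Euc m)) (f : Euc n → Euc m → Euc n)
    (l : Euc n → Euc m → ℝ) : Prop :=
  IsClosed C ∧ IsCompact (frontier C) ∧ IsClosed U ∧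
  (∀ x u, u ∈ U → 0 ≤ l x u) ∧
  (∀ Kc : Set (Euc n), IsCompact Kc → Kc ⊆ Cᶜ →
    UniformContinuousOn (fun q : Euc n × Euc m => f q.1 q.2) (Kc ×ˢ U) ∧
    UniformContinuousOn (fun q : Euc n × Euc m => l q.1 q.2) (Kc ×ˢ U)) ∧
  (∀ R : ℝ, 0 < R → ∃ M : ℝ, 0 < M ∧ ∀ x u, dC C x ≤ R → x ∉ C → u ∈ U →
    ‖f x u‖ ≤ M ∧ l x u ≤ M)

/-- Hypothesis (H1). -/
def HypH1 {n m : ℕ} (C : Set (Euc n)) (U : Set (Euc m)) (f : Euc n → Euc m → Euc n)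
    (l : Euc n → Euc m → ℝ) : Prop :=
  IsClosed C ∧ IsCompact (frontier C) ∧ IsClosed U ∧
  (∀ x u, u ∈ U → 0 ≤ l x u) ∧
  ContinuousOn (fun q : Euc n × Euc m => f q.1 q.2) (closure Cᶜ ×ˢ U) ∧
  ContinuousOn (fun q : Euc n × Euc m => l q.1 q.2) (closure Cᶜ ×ˢ U) ∧
  (∀ Kc : Set (Euc n), IsCompact Kc → Kc ⊆ closure Cᶜ →
    ∃ Mf Ml Lf Ll : ℝ, 0 < Mf ∧ 0 < Ml ∧ 0 < Lf ∧ 0 < Ll ∧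
      (∀ x ∈ Kc, ∀ u ∈ U, ‖f x u‖ ≤ Mf ∧ l x u ≤ Ml) ∧
      (∀ x₁ ∈ Kc, ∀ x₂ ∈ Kc, ∀ u ∈ U,
        ‖f x₁ u - f x₂ u‖ ≤ Lf * ‖x₁ - x₂‖ ∧ |l x₁ u - l x₂ u| ≤ Ll * ‖x₁ - x₂‖))

/-- A partition of `[0,∞)`. -/
structure TimePartition where
  t : ℕ → ℝ
  zero : t 0 = 0
  mono : StrictMono t
  unbounded : Tendsto t atTop atTop

/-- A class-`KL` comparison function. -/
structure IsKL (β : ℝ → ℝ → ℝ) : Prop where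
  nonneg : ∀ r t, 0 ≤ r → 0 ≤ t → 0 ≤ β r t
  cont : ∀ t, 0 ≤ t → ContinuousOn (fun r => β r t) (Set.Ici 0)
  strictMono : ∀ t, 0 ≤ t → StrictMonoOn (fun r => β r t) (Set.Ici 0)
  zero : ∀ t, 0 ≤ t → β 0 t = 0
  anti : ∀ r, 0 ≤ r → AntitoneOn (fun t => β r t) (Set.Ici 0)
  tendsto : ∀ r, 0 ≤ r → Tendsto (fun t => β r t) atTop (𝓝 0)

/-- `(x,u)` is a `π`-sampling trajectory-control pair from `z` associated with the
feedback `K`, with exit time `T`; trajectories reaching the target at a finite exit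
time are extended to `[0,∞)` by their limit value. -/
structure IsSamplingSol {n m : ℕ} (C : Set (Euc n)) (U : Set (Euc m))
    (f : Euc n → Euc m → Euc n) (K : Euc n → Euc m) (π : TimePartition) (z : Euc n)
    (x : ℝ → Euc n) (u : ℝ → Euc m) (T : ℝ≥0∞) : Prop where
  pos : 0 < T
  init : x 0 = z
  cont : ContinuousOn x (Set.Ici 0)
  ctrl : ∀ j : ℕ, ∀ t ∈ Set.Ico (π.t j) (π.t (j+1)), u t = K (x (π.t j))
  outside : ∀ t : ℝ, 0 ≤ t → ENNReal.ofReal t < T → x t ∉ C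
  deriv : ∀ t : ℝ, 0 < t → ENNReal.ofReal t < T → (∀ j, t ≠ π.t j) →
    HasDerivAt x (f (x t) (u t)) t
  exit : ∀ tr : ℝ, 0 ≤ tr → T = ENNReal.ofReal tr →
    dC C (x tr) = 0 ∧ ∀ s, tr ≤ s → x s = x tr

/-- The time `T̄ᵣ` after which the trajectory remains in the `r`-neighbourhood
of the target. -/
def Tbar {n : ℕ} (C : Set (Euc n)) (x : ℝ → Euc n) (r : ℝ) : ℝ :=
  sInf {t : ℝ | 0 < t ∧ ∀ τ, t ≤ τ → dC C (x τ) ≤ r}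

/-- `K` sample stabilizes the system to `C` with `(q,W)`-regulated cost, for initial
points in `Z`. -/
def SampleStabOn {n m : ℕ} (C : Set (Euc n)) (U : Set (Euc m))
    (f : Euc n → Euc m → Euc n) (l : Euc n → Euc m → ℝ) (K : Euc n → Euc m)
    (Z : Set (Euc n)) (q : ℝ) (W : Euc n → ℝ) : Prop :=
  ∃ β : ℝ → ℝ → ℝ, IsKL β ∧
    ∀ r R : ℝ, 0 < r → r < R → ∃ δ > (0:ℝ),
      ∀ π : TimePartition, (∀ j, π.t (j+1) - π.t j ≤ δ) →
      ∀ z ∈ Z, dC C z ≤ R →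
      ∀ x u T, IsSamplingSol C U f K π z x u T →
        (∀ t, 0 ≤ t → dC C (x t) ≤ max (β R t) r) ∧
        (∫ τ in (0:ℝ)..(Tbar C x r), l (x τ) (u τ)) ≤ W z / q

/-- `X` is an Euler trajectory of the system from `z` associated with `K`. -/
def IsEulerTraj {n m : ℕ} (C : Set (Euc n)) (U : Set (Euc m))
    (f : Euc n → Euc m → Euc n) (K : Euc n → Euc m) (z : Euc n) (X : ℝ → Euc n) : Prop :=
  ∃ (π : ℕ → TimePartition) (x : ℕ → ℝ → Euc n) (u : ℕ → ℝ → Euc m)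
    (T : ℕ → ℝ≥0∞) (δ : ℕ → ℝ),
    Tendsto δ atTop (𝓝 0) ∧ (∀ i j, (π i).t (j+1) - (π i).t j ≤ δ i) ∧
    (∀ i, IsSamplingSol C U f K (π i) z (x i) (u i) (T i)) ∧
    TendstoLocallyUniformlyOn x X atTop (Set.Ici 0)

/-- `(X, X⁰)` is an Euler trajectory-cost pair from `z` associated with `K`. -/
def IsEulerPair {n m : ℕ} (C : Set (Euc n)) (U : Set (Euc m))
    (f : Euc n → Euc m → Euc n) (l : Euc n → Euc m → ℝ) (K : Euc n → Euc m)
    (z : Euc n) (X : ℝ → Euc n) (X0 : ℝ → ℝ) : Prop :=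
  ∃ (π : ℕ → TimePartition) (x : ℕ → ℝ → Euc n) (u : ℕ → ℝ → Euc m)
    (T : ℕ → ℝ≥0∞) (δ : ℕ → ℝ),
    Tendsto δ atTop (𝓝 0) ∧ (∀ i j, (π i).t (j+1) - (π i).t j ≤ δ i) ∧
    (∀ i, IsSamplingSol C U f K (π i) z (x i) (u i) (T i)) ∧
    TendstoLocallyUniformlyOn x X atTop (Set.Ici 0) ∧
    TendstoLocallyUniformlyOn (fun i s => ∫ τ in (0:ℝ)..s, l (x i τ) (u i τ)) X0
      atTop (Set.Ici 0)

/-- The filter of approach to `T` from the left (`atTop` when `T = ∞`). -/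
def leftFilter (T : ℝ≥0∞) : Filter ℝ :=
  if T = ⊤ then Filter.atTop else nhdsWithin T.toReal (Set.Iio T.toReal)

/-- The exit time `T_X` of a (Euler) trajectory `X`. -/
def exitTimeInf {n : ℕ} (C : Set (Euc n)) (X : ℝ → Euc n) : ℝ≥0∞ :=
  sInf {τ : ℝ≥0∞ | 0 < τ ∧ (∀ t : ℝ, 0 ≤ t → ENNReal.ofReal t < τ → X t ∉ C) ∧
    Tendsto (fun t => dC C (X t)) (leftFilter τ) (𝓝 0)}

/-- `K` Euler stabilizes the system to `C` with `(q,W)`-regulated cost, for initial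
points in `Z`. -/
def EulerStabOn {n m : ℕ} (C : Set (Euc n)) (U : Set (Euc m))
    (f : Euc n → Euc m → Euc n) (l : Euc n → Euc m → ℝ) (K : Euc n → Euc m)
    (Z : Set (Euc n)) (q : ℝ) (W : Euc n → ℝ) : Prop :=
  ∃ β : ℝ → ℝ → ℝ, IsKL β ∧
    ∀ z ∈ Z,
      (∀ X, IsEulerTraj C U f K z X → ∀ t, 0 ≤ t → dC C (X t) ≤ β (dC C z) t) ∧
      (∀ X X0, IsEulerPair C U f l K z X X0 →
        ∀ t, 0 ≤ t → ENNReal.ofReal t < exitTimeInf C X → X0 t ≤ W z / q)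

/-- A locally bounded feedback taking values in the control set. -/
def IsFeedback {n m : ℕ} (C : Set (Euc n)) (U : Set (Euc m)) (K : Euc n → Euc m) : Prop :=
  (∀ x, x ∉ C → K x ∈ U) ∧
  ∀ x, x ∉ C → ∃ V ∈ 𝓝 x, Bornology.IsBounded (K '' (V \ C))

/-- `K` is a `W`-feedback: for the selection `psel x ∈ D*W(x)`, `K x` minimizes
`u ↦ ⟪psel x, f(x,u)⟫ + p₀ l(x,u)` over `U ∩ B(0, N(W x))`. -/
def IsWFeedback {n m : ℕ} (C : Set (Euc n)) (U : Set (Euc m))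
    (f : Euc n → Euc m → Euc n) (l : Euc n → Euc m → ℝ) (p0 : ℝ) (W : Euc n → ℝ)
    (N : ℝ → ℝ) (psel : Euc n → Euc n) (K : Euc n → Euc m) : Prop :=
  ∀ x, x ∉ C →
    K x ∈ U ∩ Metric.closedBall 0 (N (W x)) ∧
    ∀ v ∈ U ∩ Metric.closedBall 0 (N (W x)),
      ⟪psel x, f x (K x)⟫ + p0 * l x (K x) ≤ ⟪psel x, f x v⟫ + p0 * l x v

/-- `(x,u)` is an admissible trajectory-control pair from `z` with exit time `T`. -/
structure IsAdmissiblePair {n m : ℕ} (C : Set (Euc n)) (U : Set (Euc m))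
    (f : Euc n → Euc m → Euc n) (z : Euc n) (x : ℝ → Euc n) (u : ℝ → Euc m)
    (T : ℝ≥0∞) : Prop where
  pos : 0 < T
  init : x 0 = z
  outside : ∀ t : ℝ, 0 ≤ t → ENNReal.ofReal t < T → x t ∉ C
  ctrlmem : ∀ t : ℝ, 0 ≤ t → ENNReal.ofReal t < T → u t ∈ U
  meas : AEStronglyMeasurable u volume
  locbdd : ∀ b : ℝ, 0 ≤ b → ENNReal.ofReal b < T →
    ∃ M : ℝ, ∀ᵐ s ∂volume, s ∈ Set.Icc (0:ℝ) b → ‖u s‖ ≤ M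
  sol : ∀ t : ℝ, 0 ≤ t → ENNReal.ofReal t < T →
    x t = z + ∫ s in (0:ℝ)..t, f (x s) (u s)

end

/-! ### Comparison functions -/

/-- A monotone/antitone bound is dominated by a `KL` function. -/
lemma exists_KL_ge (b : ℝ → ℝ → ℝ)
    (hnn : ∀ r t, 0 ≤ b r t)
    (hmono : ∀ t, 0 ≤ t → Monotone (fun r => b r t))
    (hanti : ∀ r, AntitoneOn (fun t => b r t) (Set.Ici 0))
    (hlim : ∀ r, 0 ≤ r → Tendsto (fun t => b r t) atTop (𝓝 0))
    (hzero : ∀ ε > 0, ∃ ρ > 0, b ρ 0 < ε) :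
    ∃ β : ℝ → ℝ → ℝ, IsKL β ∧ ∀ r t, 0 ≤ r → 0 ≤ t → b r t ≤ β r t := by
  have hb0 : ∀ t, 0 ≤ t → b 0 t = 0 := by
    intro t ht
    refine le_antisymm (le_of_forall_pos_lt_add ?_) (hnn 0 t)
    intro ε hε
    obtain ⟨ρ, hρ, h⟩ := hzero ε hε
    have h1 := hmono t ht hρ.le
    have h2 := hanti ρ (Set.mem_Ici.2 le_rfl) (Set.mem_Ici.2 ht) ht
    simp only at h1 h2
    linarith
  have hInt : ∀ t, 0 ≤ t → ∀ c d : ℝ, IntervalIntegrable (fun r => b r t) volume c d :=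
    fun t ht c d => (hmono t ht).intervalIntegrable
  have hmono' : ∀ t, 0 ≤ t → ∀ r, 0 ≤ r → Monotone (fun v => b (r * v) t) := by
    intro t ht r hr v w hvw
    exact hmono t ht (mul_le_mul_of_nonneg_left hvw hr)
  have hInt' : ∀ t, 0 ≤ t → ∀ r, 0 ≤ r → ∀ c d : ℝ,
      IntervalIntegrable (fun v => b (r * v) t) volume c d :=
    fun t ht r hr c d => (hmono' t ht r hr).intervalIntegrable
  set J : ℝ → ℝ → ℝ := fun r t => ∫ v in (1:ℝ)..2, b (r * v) t with hJ
  have hJnn : ∀ r t, 0 ≤ J r t := fun r t =>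
    intervalIntegral.integral_nonneg (by norm_num) (fun v _ => hnn _ _)
  have hJge : ∀ r t, 0 ≤ r → 0 ≤ t → b r t ≤ J r t := by
    intro r t hr ht
    have : ∫ v in (1:ℝ)..2, b r t ≤ J r t := by
      refine intervalIntegral.integral_mono_on (by norm_num) (by simp) (hInt' t ht r hr _ _) ?_
      intro v hv
      exact hmono t ht (by nlinarith [hv.1])
    simpa [show (2:ℝ) - 1 = 1 by norm_num] using this
  have hJle : ∀ r t, 0 ≤ r → 0 ≤ t → J r t ≤ b (2 * r) t := by
    intro r t hr ht
    have : J r t ≤ ∫ v in (1:ℝ)..2, b (2 * r) t := by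
      refine intervalIntegral.integral_mono_on (by norm_num) (hInt' t ht r hr _ _) (by simp) ?_
      intro v hv
      exact hmono t ht (by nlinarith [hv.2])
    simpa [show (2:ℝ) - 1 = 1 by norm_num] using this
  have hJmono : ∀ t, 0 ≤ t → ∀ r s, 0 ≤ r → r ≤ s → J r t ≤ J s t := by
    intro t ht r s hr hrs
    refine intervalIntegral.integral_mono_on (by norm_num) (hInt' t ht r hr _ _)
      (hInt' t ht s (hr.trans hrs) _ _) ?_
    intro v hv
    exact hmono t ht (by nlinarith [hv.1])
  refine ⟨fun r t => J r t + r * (1 + t)⁻¹, ⟨?_, ?_, ?_, ?_, ?_, ?_⟩, ?_⟩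
  · intro r t hr ht
    have := hJnn r t
    positivity
  · intro t ht
    refine ContinuousOn.add ?_ (by fun_prop)
    intro r hr
    rcases (Set.mem_Ici.1 hr).eq_or_lt with h0 | hpos
    · subst h0
      have hJ0 : J 0 t = 0 := le_antisymm (by simpa [hb0 t ht] using hJle 0 t le_rfl ht) (hJnn _ _)
      rw [Metric.continuousWithinAt_iff]
      intro ε hε
      obtain ⟨ρ, hρ, hρε⟩ := hzero ε hε
      refine ⟨ρ / 2, by positivity, ?_⟩
      intro s hs hd
      rw [hJ0, Real.dist_eq, sub_zero, abs_of_nonneg (hJnn _ _)]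
      rw [Real.dist_eq, sub_zero, abs_of_nonneg hs] at hd
      have h1 := hJle s t hs ht
      have h2 := hmono t ht (show 2 * s ≤ ρ by linarith)
      have h3 := hanti ρ (Set.mem_Ici.2 le_rfl) (Set.mem_Ici.2 ht) ht
      simp only at h2 h3
      linarith
    · have hF : Continuous fun s => ∫ v in (0:ℝ)..s, b v t :=
        intervalIntegral.continuous_primitive (hInt t ht) 0
      have hG : ContinuousAt (fun s => s⁻¹ * ((∫ v in (0:ℝ)..(s * 2), b v t) -
          ∫ v in (0:ℝ)..(s * 1), b v t)) r := by
        refine ContinuousAt.mul (continuousAt_inv₀ hpos.ne') (Continuous.continuousAt ?_)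
        exact (hF.comp (by fun_prop : Continuous fun s : ℝ => s * 2)).sub
          (hF.comp (by fun_prop : Continuous fun s : ℝ => s * 1))
      refine (hG.congr ?_).continuousWithinAt
      filter_upwards [lt_mem_nhds hpos] with s hs
      rw [hJ]
      simp only
      rw [intervalIntegral.integral_comp_mul_left (fun v => b v t) hs.ne',
        intervalIntegral.integral_interval_sub_left (hInt t ht _ _) (hInt t ht _ _), smul_eq_mul]
  · intro t ht r hr s hs hrs
    have h1 := hJmono t ht r s hr hrs.le
    have h2 : r * (1 + t)⁻¹ < s * (1 + t)⁻¹ := by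
      apply mul_lt_mul_of_pos_right hrs
      positivity
    simp only
    linarith
  · intro t ht
    have hJ0 : J 0 t = 0 := le_antisymm (by simpa [hb0 t ht] using hJle 0 t le_rfl ht) (hJnn _ _)
    simp [hJ0]
  · intro r hr t ht s hs hts
    have h1 : J r s ≤ J r t := by
      refine intervalIntegral.integral_mono_on (by norm_num) (hInt' s hs r hr _ _)
        (hInt' t ht r hr _ _) ?_
      intro v hv
      exact hanti _ ht hs hts
    have h2 : r * (1 + s)⁻¹ ≤ r * (1 + t)⁻¹ := by
      apply mul_le_mul_of_nonneg_left _ hr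
      have ht' : (0:ℝ) ≤ t := ht
      exact inv_anti₀ (by linarith) (by linarith)
    simp only
    linarith
  · intro r hr
    have h1 : Tendsto (fun t => J r t) atTop (𝓝 0) := by
      refine squeeze_zero' (Eventually.of_forall fun t => hJnn r t) ?_
        (hlim (2 * r) (by linarith))
      filter_upwards [eventually_ge_atTop 0] with t ht
      exact hJle r t hr ht
    have h2 : Tendsto (fun t : ℝ => r * (1 + t)⁻¹) atTop (𝓝 (r * 0)) :=
      (tendsto_inv_atTop_zero.comp (tendsto_atTop_add_const_left _ 1 tendsto_id)).const_mul r
    simpa using h1.add h2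
  · intro r t hr ht
    have := hJge r t hr ht
    have : 0 ≤ r * (1 + t)⁻¹ := by positivity
    have := hJge r t hr ht
    simp only
    linarith

/-- Turning a family of admissible sampling times into a radius function. -/
lemma exists_radius (R : ℝ) (hR : 0 < R) (P : ℝ → ℝ → Prop)
    (hP : ∀ ρ, 0 < ρ → ∃ δ > 0, P δ ρ)
    (hδ : ∀ δ δ' ρ, 0 < δ' → δ' ≤ δ → P δ ρ → P δ' ρ)
    (hρ : ∀ δ ρ ρ', ρ ≤ ρ' → P δ ρ → P δ ρ') :
    ∃ δR > (0:ℝ), ∃ r : ℝ → ℝ,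
      ContinuousOn r (Set.Icc 0 δR) ∧ StrictMonoOn r (Set.Icc 0 δR) ∧
      r 0 = 0 ∧ r δR = R ∧ (∀ δ ∈ Set.Icc (0:ℝ) δR, r δ ∈ Set.Icc (0:ℝ) R) ∧
      ∀ δ, 0 < δ → δ < δR → P δ (r δ) := by
  set A : ℝ → Set ℝ := fun ρ => {δ | 0 < δ ∧ δ ≤ 1 ∧ 0 < ρ ∧ P δ ρ} with hA
  have hAb : ∀ ρ, BddAbove (A ρ) := fun ρ => ⟨1, fun δ h => h.2.1⟩
  set D : ℝ → ℝ := fun ρ => sSup (A ρ) with hD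
  have hAne : ∀ ρ, 0 < ρ → (A ρ).Nonempty := by
    intro ρ h
    obtain ⟨δ, h1, h2⟩ := hP ρ h
    exact ⟨min δ 1, by positivity, min_le_right _ _, h,
      hδ δ _ ρ (by positivity) (min_le_left _ _) h2⟩
  have hDnn : ∀ ρ, 0 ≤ D ρ := fun ρ => Real.sSup_nonneg (fun δ h => h.1.le)
  have hDpos : ∀ ρ, 0 < ρ → 0 < D ρ := by
    intro ρ h
    obtain ⟨δ, h1⟩ := hAne ρ h
    exact lt_of_lt_of_le h1.1 (le_csSup (hAb ρ) h1)
  have hDmono : Monotone D := by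
    intro ρ ρ' h
    by_cases h0 : 0 < ρ
    · refine csSup_le_csSup (hAb ρ') (hAne ρ h0) ?_
      rintro δ ⟨h1, h2, h3, h4⟩
      exact ⟨h1, h2, by linarith, hρ δ ρ ρ' h h4⟩
    · have : A ρ = ∅ := by
        ext δ; simp only [hA, Set.mem_setOf_eq, Set.mem_empty_iff_false, iff_false]
        tauto
      have h1 : D ρ = 0 := by simp [hD, this]
      rw [h1]; exact hDnn _
  have hDP : ∀ δ ρ, 0 < δ → 0 < ρ → δ < D ρ → P δ ρ := by
    intro δ ρ h1 h2 h3
    obtain ⟨δ', h4, h5⟩ := exists_lt_of_lt_csSup (hAne ρ h2) h3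
    exact hδ δ' δ ρ h1 h5.le h4.2.2.2
  have hInt : ∀ c d : ℝ, IntervalIntegrable D volume c d := fun c d => hDmono.intervalIntegrable
  set g : ℝ → ℝ := fun ρ => (2 * R)⁻¹ * ∫ s in (0:ℝ)..ρ, D s with hg
  have hgc : Continuous g := continuous_const.mul (intervalIntegral.continuous_primitive hInt 0)
  have hg0 : g 0 = 0 := by simp [hg]
  have hRi : 0 < (2 * R)⁻¹ := by positivity
  have hgm : StrictMonoOn g (Set.Icc 0 R) := by
    intro ρ h ρ' h' hlt
    have h1 : (∫ s in (0:ℝ)..ρ', D s) - ∫ s in (0:ℝ)..ρ, D s = ∫ s in ρ..ρ', D s :=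
      intervalIntegral.integral_interval_sub_left (hInt _ _) (hInt _ _)
    have h2 : 0 < ∫ s in ρ..ρ', D s :=
      intervalIntegral.intervalIntegral_pos_of_pos_on (hInt _ _)
        (fun s hs => hDpos s (lt_of_le_of_lt h.1 hs.1)) hlt
    exact mul_lt_mul_of_pos_left (by linarith) hRi
  have hgD : ∀ ρ, 0 < ρ → ρ ≤ R → g ρ < D ρ := by
    intro ρ h h'
    have h1 : ∫ s in (0:ℝ)..ρ, D s ≤ ∫ s in (0:ℝ)..ρ, D ρ :=
      intervalIntegral.integral_mono_on h.le (hInt _ _) (by simp) (fun s hs => hDmono hs.2)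
    have h2 : ∫ s in (0:ℝ)..ρ, D ρ = ρ * D ρ := by simp
    have h3 := hDpos ρ h
    have h4 : g ρ ≤ (2 * R)⁻¹ * (R * D ρ) := by
      apply mul_le_mul_of_nonneg_left _ hRi.le
      rw [h2] at h1
      exact h1.trans (mul_le_mul_of_nonneg_right h' h3.le)
    have h5 : (2 * R)⁻¹ * (R * D ρ) = D ρ / 2 := by field_simp
    linarith
  have h0m : (0:ℝ) ∈ Set.Icc 0 R := ⟨le_rfl, hR.le⟩
  have hRm : R ∈ Set.Icc 0 R := ⟨hR.le, le_rfl⟩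
  have hgR : 0 < g R := by rw [← hg0]; exact hgm h0m hRm hR
  have himg : g '' Set.Icc 0 R = Set.Icc 0 (g R) := by
    apply Set.Subset.antisymm
    · rintro _ ⟨ρ, h, rfl⟩
      exact ⟨by rw [← hg0]; exact hgm.monotoneOn h0m h h.1, hgm.monotoneOn h hRm h.2⟩
    · have := intermediate_value_Icc hR.le hgc.continuousOn
      rwa [hg0] at this
  set r : ℝ → ℝ := Function.invFunOn g (Set.Icc 0 R) with hr
  have hrm : ∀ δ ∈ Set.Icc (0:ℝ) (g R), r δ ∈ Set.Icc (0:ℝ) R := by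
    intro δ h
    rw [← himg] at h
    exact Function.invFunOn_mem h
  have hgr : ∀ δ ∈ Set.Icc (0:ℝ) (g R), g (r δ) = δ := by
    intro δ h
    rw [← himg] at h
    exact Function.invFunOn_eq h
  have hrg : ∀ ρ ∈ Set.Icc (0:ℝ) R, r (g ρ) = ρ := by
    intro ρ h
    have h1 : g ρ ∈ Set.Icc 0 (g R) := by rw [← himg]; exact ⟨ρ, h, rfl⟩
    exact hgm.injOn (hrm _ h1) h (hgr _ h1)
  have hrmono : StrictMonoOn r (Set.Icc 0 (g R)) := by
    intro δ h δ' h' hlt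
    rw [← hgm.lt_iff_lt (hrm _ h) (hrm _ h'), hgr _ h, hgr _ h']
    exact hlt
  have hr0 : r 0 = 0 := by
    have := hrg 0 h0m
    rwa [hg0] at this
  have hrR : r (g R) = R := hrg R hRm
  have hrimg : r '' Set.Icc 0 (g R) = Set.Icc 0 R := by
    apply Set.Subset.antisymm
    · rintro _ ⟨δ, h, rfl⟩
      exact hrm δ h
    · intro ρ h
      exact ⟨g ρ, by rw [← himg]; exact ⟨ρ, h, rfl⟩, hrg ρ h⟩
  refine ⟨g R, hgR, r, ?_, hrmono, hr0, hrR, hrm, ?_⟩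
  · have hcl : Set.LeftInvOn r g (Set.Icc 0 R) := fun ρ h => hrg ρ h
    rw [continuousOn_iff_isClosed]
    intro F hF
    refine ⟨g '' (F ∩ Set.Icc 0 R), ((isCompact_Icc.inter_left hF).image hgc).isClosed, ?_⟩
    ext δ
    constructor
    · rintro ⟨h1, h2⟩
      exact ⟨⟨r δ, ⟨h1, hrm δ h2⟩, hgr δ h2⟩, h2⟩
    · rintro ⟨⟨ρ, ⟨h1, h2⟩, rfl⟩, h3⟩
      refine ⟨?_, h3⟩
      simpa [hrg ρ h2] using h1
  · intro δ h1 h2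
    have hm : δ ∈ Set.Icc 0 (g R) := ⟨h1.le, h2.le⟩
    have h3 : 0 < r δ := by
      rw [← hr0]
      exact hrmono ⟨le_rfl, hgR.le⟩ hm h1
    apply hDP δ _ h1 h3
    have := hgD (r δ) h3 (hrm δ hm).2
    rwa [hgr δ hm] at this

/-! ### Geometry of the target and of `W` -/

lemma dC_nonneg {n : ℕ} (C : Set (Euc n)) (y : Euc n) : 0 ≤ dC C y := Metric.infDist_nonneg

lemma continuous_dC {n : ℕ} (C : Set (Euc n)) : Continuous (dC C) :=
  Metric.continuous_infDist_pt C

lemma mem_frontier_of {n : ℕ} {C : Set (Euc n)} {y : Euc n} (hy : y ∈ closure Cᶜ)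
    (hyC : y ∈ C) : y ∈ frontier C := by
  rw [frontier_eq_closure_inter_closure]
  exact ⟨subset_closure hyC, hy⟩

lemma mem_of_dC_eq_zero {n : ℕ} {C : Set (Euc n)} (hC : IsClosed C) (hne : C.Nonempty)
    {y : Euc n} (hy : dC C y = 0) : y ∈ C :=
  (hC.mem_iff_infDist_zero hne).2 hy

lemma isCompact_AR {n : ℕ} {C : Set (Euc n)} (hne : C.Nonempty)
    (hfr : IsCompact (frontier C)) (R : ℝ) :
    IsCompact (closure Cᶜ ∩ {y | dC C y ≤ R}) := by
  have hsub : closure Cᶜ ∩ {y | dC C y ≤ R} ⊆ Metric.cthickening (max R 0) (frontier C) := by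
    rintro y ⟨hy, hyR⟩
    have hyR' : dC C y ≤ R := hyR
    by_cases hyC : y ∈ C
    · exact Metric.self_subset_cthickening _ (mem_frontier_of hy hyC)
    · have h1 : Cᶜ ≠ Set.univ := by
        intro h
        obtain ⟨c, hc⟩ := hne
        have : c ∈ Cᶜ := by rw [h]; trivial
        exact this hc
      obtain ⟨c, hc, hd⟩ := exists_mem_frontier_infDist_compl_eq_dist
        (show y ∈ Cᶜ from hyC) h1
      rw [frontier_compl] at hc
      rw [compl_compl] at hd
      refine Metric.mem_cthickening_of_dist_le y c _ _ hc ?_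
      rw [← hd]
      exact hyR'.trans (le_max_left _ _)
  refine (hfr.cthickening (r := max R 0)).of_isClosed_subset ?_ hsub
  exact isClosed_closure.inter (isClosed_le (continuous_dC C) continuous_const)

lemma W_bdd {n : ℕ} {C : Set (Euc n)} (hne : C.Nonempty)
    (hfr : IsCompact (frontier C)) {W : Euc n → ℝ} (hWc : ContinuousOn W (closure Cᶜ)) (R : ℝ) :
    ∃ w > 0, ∀ y ∈ closure Cᶜ, dC C y ≤ R → W y ≤ w := by
  have h := (isCompact_AR hne hfr R).bddAbove_image (hWc.mono Set.inter_subset_left)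
  obtain ⟨w, hw⟩ := h
  refine ⟨max w 1, by positivity, fun y hy hd => ?_⟩
  exact (hw ⟨y, ⟨hy, hd⟩, rfl⟩).trans (le_max_left _ _)

lemma isCompact_W_le {n : ℕ} {C : Set (Euc n)} {W : Euc n → ℝ}
    (hP : ProperOn C W) (w : ℝ) :
    IsCompact (closure Cᶜ ∩ W ⁻¹' Set.Icc 0 w) :=
  hP (Set.Icc 0 w) isCompact_Icc (fun _ h => h.1)

lemma d_bdd {n : ℕ} {C : Set (Euc n)} {W : Euc n → ℝ}
    (hnn : ∀ x ∈ closure Cᶜ, 0 ≤ W x) (hP : ProperOn C W) (w : ℝ) :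
    ∃ D > 0, ∀ y ∈ closure Cᶜ, W y ≤ w → dC C y ≤ D := by
  obtain ⟨D, hD⟩ := (isCompact_W_le hP w).bddAbove_image (continuous_dC C).continuousOn
  refine ⟨max D 1, by positivity, fun y hy hd => ?_⟩
  exact (hD ⟨y, ⟨hy, hnn y hy, hd⟩, rfl⟩).trans (le_max_left _ _)

lemma d_small {n : ℕ} {C : Set (Euc n)} {W : Euc n → ℝ}
    (hWc : ContinuousOn W (closure Cᶜ))
    (hnn : ∀ x ∈ closure Cᶜ, 0 ≤ W x) (hpd : PosDefOn C W) (hP : ProperOn C W)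
    (ε : ℝ) (hε : 0 < ε) :
    ∃ w > 0, ∀ y ∈ closure Cᶜ, W y ≤ w → dC C y < ε := by
  set S := (closure Cᶜ ∩ W ⁻¹' Set.Icc 0 1) ∩ {y | ε ≤ dC C y} with hS
  have hSc : IsCompact S :=
    (isCompact_W_le hP 1).inter_right (isClosed_le continuous_const (continuous_dC C))
  rcases S.eq_empty_or_nonempty with h0 | hne
  · refine ⟨1, one_pos, fun y hy hW => ?_⟩
    by_contra hcon
    have : y ∈ S := ⟨⟨hy, hnn y hy, hW⟩, not_lt.1 hcon⟩
    rw [h0] at this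
    exact this
  · obtain ⟨y0, hy0, hmin⟩ := hSc.exists_isMinOn hne
      (hWc.mono (fun y hy => hy.1.1))
    have hy0C : y0 ∉ C := by
      intro h
      have h1 : dC C y0 = 0 := Metric.infDist_zero_of_mem h
      have h2 : ε ≤ dC C y0 := hy0.2
      linarith
    have hpos := hpd.1 y0 hy0C
    refine ⟨min 1 (W y0 / 2), by positivity, fun y hy hW => ?_⟩
    by_contra hcon
    have : y ∈ S := ⟨⟨hy, hnn y hy, hW.trans (min_le_left _ _)⟩, not_lt.1 hcon⟩
    have h1 : W y0 ≤ W y := hmin this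
    have h2 := hW.trans (min_le_right _ _)
    linarith

lemma W_small {n : ℕ} {C : Set (Euc n)} (hC : IsClosed C) (hne : C.Nonempty)
    (hfr : IsCompact (frontier C)) {W : Euc n → ℝ} (hWc : ContinuousOn W (closure Cᶜ))
    (hpd : PosDefOn C W) (ε : ℝ) (hε : 0 < ε) :
    ∃ ρ > 0, ∀ y ∈ closure Cᶜ, dC C y ≤ ρ → W y < ε := by
  have hA := isCompact_AR hne hfr 1
  set A := closure Cᶜ ∩ {y | dC C y ≤ 1} with hAdef
  have hS : IsCompact (A ∩ W ⁻¹' Set.Ici ε) := by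
    refine hA.of_isClosed_subset ?_ Set.inter_subset_left
    exact (hWc.mono Set.inter_subset_left).preimage_isClosed_of_isClosed hA.isClosed isClosed_Ici
  rcases (A ∩ W ⁻¹' Set.Ici ε).eq_empty_or_nonempty with h0 | hne'
  · refine ⟨1, one_pos, fun y hy hd => ?_⟩
    by_contra hcon
    have : y ∈ A ∩ W ⁻¹' Set.Ici ε := ⟨⟨hy, hd⟩, not_lt.1 hcon⟩
    rw [h0] at this
    exact this
  · obtain ⟨y0, hy0, hmin⟩ := hS.exists_isMinOn hne' (continuous_dC C).continuousOn
    have hpos : 0 < dC C y0 := by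
      refine lt_of_le_of_ne (dC_nonneg C y0) (fun h => ?_)
      have h1 := hpd.2 y0 (mem_frontier_of hy0.1.1 (mem_of_dC_eq_zero hC hne h.symm))
      have h2 : ε ≤ W y0 := hy0.2
      linarith
    refine ⟨min 1 (dC C y0 / 2), by positivity, fun y hy hd => ?_⟩
    by_contra hcon
    have : y ∈ A ∩ W ⁻¹' Set.Ici ε := ⟨⟨hy, hd.trans (min_le_left _ _)⟩, not_lt.1 hcon⟩
    have h1 : dC C y0 ≤ dC C y := hmin this
    have h2 := hd.trans (min_le_right _ _)
    linarith

/-! ### Semiconcavity -/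

lemma semiconc_diff {n : ℕ} {W : Euc n → ℝ} {S : Set (Euc n)} {ρ : ℝ}
    (hρ : ∀ x y : Euc n, segment ℝ x y ⊆ S →
      W x + W y - 2 * W (midpoint ℝ x y) ≤ ρ * ‖x - y‖ ^ 2)
    {x y : Euc n} (hxy : segment ℝ x y ⊆ S) (hd : DifferentiableAt ℝ W x) :
    W y - W x ≤ ⟪gradient W x, y - x⟫ + 2 * ρ * ‖y - x‖ ^ 2 := by
  set h := y - x with hh
  set a : ℕ → ℝ := fun k => (W (x + ((1/2:ℝ)^k) • h) - W x) / (1/2:ℝ)^k with ha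
  have hstep : ∀ k, a k ≤ a (k+1) + ρ * ‖h‖^2 * (1/2:ℝ)^k := by
    intro k
    have hq : (0:ℝ) < (1/2:ℝ)^k := by positivity
    have hq1 : (1/2:ℝ)^k ≤ 1 := pow_le_one₀ (by norm_num) (by norm_num)
    set q := (1/2:ℝ)^k with hqdef
    have hseg : segment ℝ x (x + q • h) ⊆ S := by
      refine Set.Subset.trans ?_ hxy
      refine (convex_segment x y).segment_subset (left_mem_segment ℝ x y) ?_
      rw [segment_eq_image']
      exact ⟨q, ⟨hq.le, hq1⟩, rfl⟩
    have h1 := hρ x (x + q • h) hseg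
    have hmid : midpoint ℝ x (x + q • h) = x + (q * (1/2)) • h := by
      rw [midpoint_eq_smul_add, invOf_eq_inv]
      module
    have hn : ‖x - (x + q • h)‖ ^ 2 = q^2 * ‖h‖^2 := by
      rw [sub_add_cancel_left, norm_neg, norm_smul, Real.norm_of_nonneg hq.le, mul_pow]
    rw [hmid, hn] at h1
    simp only [ha, pow_succ]
    rw [← hqdef]
    have h2 : (W (x + q • h) - W x) / q ≤
        (2 * (W (x + (q * (1/2)) • h) - W x) + ρ * (q^2 * ‖h‖^2)) / q := by
      apply div_le_div_of_nonneg_right _ hq.le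
      linarith
    refine h2.trans (le_of_eq ?_)
    field_simp
  have hsum : ∀ k, a 0 ≤ a k + 2 * (ρ * ‖h‖^2) * (1 - (1/2:ℝ)^k) := by
    intro k
    induction k with
    | zero => simp
    | succ k ih =>
      have := hstep k
      rw [pow_succ (1/2:ℝ) k]
      linarith
  have hder : HasDerivAt (fun t : ℝ => W (x + t • h)) ⟪gradient W x, h⟫ 0 := by
    have h1 : HasFDerivAt W (InnerProductSpace.toDual ℝ (Euc n) (gradient W x)) x :=
      hd.hasGradientAt.hasFDerivAt
    have h2 : HasDerivAt (fun t : ℝ => x + t • h) h 0 := by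
      simpa using ((hasDerivAt_id (0:ℝ)).smul_const h).const_add x
    have h1' : HasFDerivAt W (InnerProductSpace.toDual ℝ (Euc n) (gradient W x))
        (x + (0:ℝ) • h) := by simpa using h1
    have := h1'.comp_hasDerivAt (0:ℝ) h2
    rw [InnerProductSpace.toDual_apply_apply] at this
    exact this
  have hpow : Tendsto (fun k : ℕ => (1/2:ℝ)^k) atTop (𝓝 0) :=
    tendsto_pow_atTop_nhds_zero_of_lt_one (by norm_num) (by norm_num)
  have hpow' : Tendsto (fun k : ℕ => (1/2:ℝ)^k) atTop (𝓝[≠] 0) :=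
    tendsto_nhdsWithin_iff.2 ⟨hpow, Eventually.of_forall fun k => by
      have : (0:ℝ) < (1/2:ℝ)^k := by positivity
      exact this.ne'⟩
  have hlim : Tendsto a atTop (𝓝 ⟪gradient W x, h⟫) := by
    have := (hasDerivAt_iff_tendsto_slope.1 hder).comp hpow'
    refine this.congr (fun k => ?_)
    simp [slope_def_field, ha]
  have hlim2 : Tendsto (fun k => a k + 2 * (ρ * ‖h‖^2) * (1 - (1/2:ℝ)^k)) atTop
      (𝓝 (⟪gradient W x, h⟫ + 2 * (ρ * ‖h‖^2) * (1 - 0))) :=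
    hlim.add ((tendsto_const_nhds.sub hpow).const_mul _)
  have hfin := ge_of_tendsto' hlim2 hsum
  have ha0 : a 0 = W y - W x := by simp [ha, hh]
  rw [ha0] at hfin
  linarith

lemma semiconc_lim {n : ℕ} {W : Euc n → ℝ} {S : Set (Euc n)} {ρ : ℝ}
    (hρ : ∀ x y : Euc n, segment ℝ x y ⊆ S →
      W x + W y - 2 * W (midpoint ℝ x y) ≤ ρ * ‖x - y‖ ^ 2)
    {x p : Euc n} {η : ℝ} (hη : 0 < η) (hball : closedBall x η ⊆ S)
    (hc : ContinuousAt W x) (hp : p ∈ limitingGradients W x) {y : Euc n}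
    (hy : ‖y - x‖ ≤ η) :
    W y - W x ≤ ⟪p, y - x⟫ + 2 * ρ * ‖y - x‖ ^ 2 := by
  obtain ⟨xk, h1, h2, h3⟩ := hp
  have hev : ∀ᶠ k in atTop, W y - W (xk k) ≤
      ⟪gradient W (xk k), y - xk k⟫ + 2 * ρ * ‖y - xk k‖ ^ 2 := by
    filter_upwards [h2 (closedBall_mem_nhds x hη)] with k hk
    refine semiconc_diff hρ ?_ (h1 k).1
    refine Set.Subset.trans ((convex_closedBall x η).segment_subset hk ?_) hball
    rwa [mem_closedBall, dist_eq_norm]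
  have hys : Tendsto (fun k => y - xk k) atTop (𝓝 (y - x)) := tendsto_const_nhds.sub h2
  refine le_of_tendsto_of_tendsto (tendsto_const_nhds.sub (hc.tendsto.comp h2)) ?_ hev
  exact (h3.inner hys).add ((hys.norm.pow 2).const_mul _)

/-! ### Sampling trajectories -/

lemma contAt_of_unif {n m : ℕ} {E : Type*} [NormedAddCommGroup E] {C : Set (Euc n)}
    {U : Set (Euc m)} (hC : IsClosed C) {g : Euc n → Euc m → E}
    (hg : ∀ Kc : Set (Euc n), IsCompact Kc → Kc ⊆ Cᶜ →
      UniformContinuousOn (fun q : Euc n × Euc m => g q.1 q.2) (Kc ×ˢ U))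
    {v : Euc m} (hv : v ∈ U) {y : Euc n} (hy : y ∉ C) :
    ContinuousAt (fun x => g x v) y := by
  obtain ⟨ε, hε, hb⟩ := Metric.nhds_basis_closedBall.mem_iff.1 (hC.isOpen_compl.mem_nhds hy)
  have h1 := (hg _ (isCompact_closedBall y ε) hb).continuousOn
  have h2 : ContinuousOn (fun x => g x v) (closedBall y ε) :=
    h1.comp (f := fun x : Euc n => (x, v)) (by fun_prop) (fun x hx => ⟨hx, hv⟩)
  exact h2.continuousAt (closedBall_mem_nhds y hε)

lemma pi_nonneg (π : TimePartition) (j : ℕ) : 0 ≤ π.t j := by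
  rw [← π.zero]
  exact π.mono.monotone (Nat.zero_le j)

lemma pi_interval (π : TimePartition) (t : ℝ) (ht : 0 ≤ t) :
    ∃ j, π.t j ≤ t ∧ t < π.t (j+1) := by
  classical
  have hex : ∃ k, t < π.t k := (π.unbounded.eventually (eventually_gt_atTop t)).exists
  have h1 := Nat.find_spec hex
  have h2 : Nat.find hex ≠ 0 := by
    intro h
    rw [h, π.zero] at h1
    linarith
  obtain ⟨j, hj⟩ := Nat.exists_eq_succ_of_ne_zero h2
  refine ⟨j, ?_, by rw [hj] at h1; exact h1⟩
  have := Nat.find_min hex (show j < Nat.find hex by omega)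
  exact not_lt.1 this

section traj

variable {n m : ℕ} {C : Set (Euc n)} {U : Set (Euc m)} {f : Euc n → Euc m → Euc n}
  {K : Euc n → Euc m} {π : TimePartition} {z : Euc n} {x : ℝ → Euc n} {u : ℝ → Euc m} {T : ℝ≥0∞}

lemma sol_exit (hs : IsSamplingSol C U f K π z x u T) {t : ℝ} (hT : T ≤ ENNReal.ofReal t) :
    0 < T.toReal ∧ T = ENNReal.ofReal T.toReal ∧ T.toReal ≤ t ∧ dC C (x T.toReal) = 0 ∧
      ∀ s, T.toReal ≤ s → x s = x T.toReal := by
  have hne : T ≠ ⊤ := ne_top_of_le_ne_top ENNReal.ofReal_ne_top hT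
  have h1 : T = ENNReal.ofReal T.toReal := (ENNReal.ofReal_toReal hne).symm
  have hpos : 0 < T.toReal := ENNReal.toReal_pos hs.pos.ne' hne
  have ht0 : 0 < t := by
    have := hs.pos.trans_le hT
    exact ENNReal.ofReal_pos.1 this
  obtain ⟨h2, h3⟩ := hs.exit T.toReal hpos.le h1
  exact ⟨hpos, h1, ENNReal.toReal_le_of_le_ofReal ht0.le hT, h2, h3⟩

lemma sol_after (hs : IsSamplingSol C U f K π z x u T) {t : ℝ} (hT : T ≤ ENNReal.ofReal t) :
    dC C (x t) = 0 := by
  obtain ⟨h1, h2, h3, h4, h5⟩ := sol_exit hs hT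
  rw [h5 t h3, h4]

lemma sol_closure (hs : IsSamplingSol C U f K π z x u T) {t : ℝ} (ht : 0 ≤ t) :
    x t ∈ closure Cᶜ := by
  by_cases hT : ENNReal.ofReal t < T
  · exact subset_closure (hs.outside t ht hT)
  · obtain ⟨h1, h2, h3, h4, h5⟩ := sol_exit hs (not_lt.1 hT)
    rw [h5 t h3]
    have hc : Tendsto x (𝓝[<] T.toReal) (𝓝 (x T.toReal)) := by
      have := (hs.cont T.toReal h1.le).continuousAt (Ici_mem_nhds h1)
      exact this.tendsto.mono_left nhdsWithin_le_nhds
    refine mem_closure_of_tendsto hc ?_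
    filter_upwards [Ioo_mem_nhdsLT h1] with s hs'
    refine hs.outside s hs'.1.le ?_
    rw [h2]
    exact (ENNReal.ofReal_lt_ofReal_iff h1).2 hs'.2

lemma sol_before (hs : IsSamplingSol C U f K π z x u T) {s t : ℝ} (hst : s ≤ t)
    (hT : ENNReal.ofReal t < T) : ENNReal.ofReal s < T :=
  lt_of_le_of_lt (ENNReal.ofReal_le_ofReal hst) hT

lemma pi_ne (π : TimePartition) {j : ℕ} {s : ℝ} (h1 : π.t j < s) (h2 : s < π.t (j+1)) :
    ∀ i, s ≠ π.t i := by
  intro i hi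
  rw [hi] at h1 h2
  have := π.mono.lt_iff_lt.1 h1
  have := π.mono.lt_iff_lt.1 h2
  omega

/-- Speed estimate on a sampling interval. -/
lemma sol_speed (hC : IsClosed C)
    (hf : ∀ Kc : Set (Euc n), IsCompact Kc → Kc ⊆ Cᶜ →
      UniformContinuousOn (fun q : Euc n × Euc m => f q.1 q.2) (Kc ×ˢ U))
    (hs : IsSamplingSol C U f K π z x u T) (j : ℕ) (hTj : ENNReal.ofReal (π.t j) < T)
    (hKU : K (x (π.t j)) ∈ U) {M κ : ℝ} (hM : 0 < M)
    (hκ : M * (π.t (j+1) - π.t j) ≤ κ)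
    (hb : ∀ s, π.t j ≤ s → ENNReal.ofReal s < T → ‖x s - x (π.t j)‖ ≤ κ →
      ‖f (x s) (K (x (π.t j)))‖ < M) :
    ∀ s ∈ Set.Icc (π.t j) (π.t (j+1)), ‖x s - x (π.t j)‖ ≤ M * (s - π.t j) := by
  classical
  set a := π.t j with ha
  set b := π.t (j+1) with hbd
  set v := K (x a) with hv
  have ha0 : 0 ≤ a := pi_nonneg π j
  have hab : a < b := π.mono (Nat.lt_succ_self j)
  have hcont : ContinuousOn x (Set.Icc a b) :=
    hs.cont.mono (fun s h => ha0.trans h.1)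
  have hder : ∀ s ∈ Set.Ioo a b, ENNReal.ofReal s < T → HasDerivAt x (f (x s) v) s := by
    intro s h hT
    have := hs.deriv s (lt_of_le_of_lt ha0 h.1) hT (pi_ne π h.1 h.2)
    rwa [hs.ctrl j s ⟨h.1.le, h.2⟩] at this
  set f' : ℝ → Euc n := fun s => if ENNReal.ofReal s < T then f (x s) v else 0 with hf'
  have hTa : ∃ c, a < c ∧ c ≤ b ∧ ∀ s, s < c → ENNReal.ofReal s < T := by
    by_cases hTb : ENNReal.ofReal b < T
    · exact ⟨b, hab, le_rfl, fun s h => sol_before hs h.le hTb⟩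
    · obtain ⟨h1, h2, h3, h4, h5⟩ := sol_exit hs (not_lt.1 hTb)
      refine ⟨T.toReal, ?_, h3, ?_⟩
      · rw [h2] at hTj
        exact (ENNReal.ofReal_lt_ofReal_iff h1).1 hTj
      · intro s h
        rw [h2]
        exact (ENNReal.ofReal_lt_ofReal_iff h1).2 h
  have hderR : ∀ s ∈ Set.Ico a b, HasDerivWithinAt x (f' s) (Set.Ici s) s := by
    intro s h
    by_cases hT : ENNReal.ofReal s < T
    · rw [show f' s = f (x s) v by simp [hf', hT]]
      rcases h.1.eq_or_lt with h0 | h0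
      · subst h0
        obtain ⟨c, hac, hcb, hcT⟩ := hTa
        refine hasDerivWithinAt_Ici_of_tendsto_deriv (s := Set.Ioo a c) ?_ ?_
          (Ioo_mem_nhdsGT hac) ?_
        · intro s h
          exact (hder s ⟨h.1, h.2.trans_le hcb⟩ (hcT s h.2)).differentiableAt.differentiableWithinAt
        · exact (hcont a ⟨le_rfl, hab.le⟩).mono (fun s h => ⟨h.1.le, (h.2.trans_le hcb).le⟩)
        · have h1 : ContinuousAt (fun y => f y v) (x a) :=
            contAt_of_unif hC hf hKU (hs.outside a ha0 hTj)
          have h2 : Tendsto x (𝓝[>] a) (𝓝 (x a)) :=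
            (hs.cont a ha0).mono (fun s (h : a < s) => ha0.trans h.le)
          refine (h1.tendsto.comp h2).congr' ?_
          filter_upwards [Ioo_mem_nhdsGT hac] with s h
          exact (hder s ⟨h.1, h.2.trans_le hcb⟩ (hcT s h.2)).deriv.symm
      · exact (hder s ⟨h0, h.2⟩ hT).hasDerivWithinAt
    · rw [show f' s = 0 by simp [hf', hT]]
      obtain ⟨h1, h2, h3, h4, h5⟩ := sol_exit hs (not_lt.1 hT)
      refine (hasDerivWithinAt_const s (Set.Ici s) (x T.toReal)).congr ?_ (h5 s h3)
      intro s' hs'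
      exact h5 s' (h3.trans hs')
  refine image_norm_le_of_norm_deriv_right_lt_deriv_boundary' (f := fun s => x s - x a) (f' := f')
    (B := fun s => M * (s - a)) (B' := fun _ => M) (hcont.sub continuousOn_const) ?_ ?_ ?_ ?_ ?_
  · intro s h
    exact (hderR s h).sub_const _
  · simp
  · fun_prop
  · intro s _
    have := ((hasDerivAt_id s).sub_const a).const_mul M
    simpa using this.hasDerivWithinAt
  · intro s h hn
    by_cases hT : ENNReal.ofReal s < T
    · rw [show f' s = f (x s) v by simp [hf', hT]]
      refine hb s h.1 hT ?_
      rw [hn]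
      refine le_trans ?_ hκ
      have := h.2
      gcongr
    · rw [show f' s = 0 by simp [hf', hT]]
      simpa using hM

/-- Integral representation on a sampling interval. -/
lemma sol_ftc (hC : IsClosed C)
    (hf : ∀ Kc : Set (Euc n), IsCompact Kc → Kc ⊆ Cᶜ →
      UniformContinuousOn (fun q : Euc n × Euc m => f q.1 q.2) (Kc ×ˢ U))
    (hs : IsSamplingSol C U f K π z x u T) (j : ℕ)
    (hKU : K (x (π.t j)) ∈ U) {t : ℝ} (ht : t ∈ Set.Icc (π.t j) (π.t (j+1)))
    (hT : ENNReal.ofReal t < T) {ε : ℝ} (y : Euc n)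
    (hε : ∀ s ∈ Set.Icc (π.t j) t, ‖f (x s) (K (x (π.t j))) - y‖ ≤ ε) :
    ‖x t - x (π.t j) - (t - π.t j) • y‖ ≤ ε * (t - π.t j) := by
  set a := π.t j with ha
  set v := K (x a) with hv
  have ha0 : 0 ≤ a := pi_nonneg π j
  have hcont : ContinuousOn x (Set.Icc a t) :=
    hs.cont.mono (fun s h => ha0.trans h.1)
  have hfc : ContinuousOn (fun s => f (x s) v) (Set.Icc a t) := by
    intro s h
    have h1 : ContinuousAt (fun y => f y v) (x s) :=
      contAt_of_unif hC hf hKU (hs.outside s (ha0.trans h.1) (sol_before hs h.2 hT))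
    exact h1.comp_continuousWithinAt (hcont s h)
  have hInt : IntervalIntegrable (fun s => f (x s) v) volume a t :=
    hfc.intervalIntegrable_of_Icc ht.1
  have h1 : ∫ s in a..t, f (x s) v = x t - x a := by
    refine intervalIntegral.integral_eq_sub_of_hasDerivAt_of_le ht.1 hcont ?_ hInt
    intro s h
    have := hs.deriv s (lt_of_le_of_lt ha0 h.1) (sol_before hs h.2.le hT)
      (pi_ne π h.1 (h.2.trans_le ht.2))
    rwa [hs.ctrl j s ⟨h.1.le, h.2.trans_le ht.2⟩] at this
  have h2 : x t - x a - (t - a) • y = ∫ s in a..t, (f (x s) v - y) := by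
    rw [intervalIntegral.integral_sub hInt (by simp), h1, intervalIntegral.integral_const]
  rw [h2]
  refine (intervalIntegral.norm_integral_le_of_norm_le_const (C := ε) ?_).trans ?_
  · intro s h
    rw [Set.uIoc_of_le ht.1] at h
    exact hε s ⟨h.1.le, h.2⟩
  · rw [abs_of_nonneg (by linarith [ht.1])]

/-- Running cost on a sampling interval. -/
lemma sol_cost {l : Euc n → Euc m → ℝ} (hC : IsClosed C)
    (hl : ∀ Kc : Set (Euc n), IsCompact Kc → Kc ⊆ Cᶜ →
      UniformContinuousOn (fun q : Euc n × Euc m => l q.1 q.2) (Kc ×ˢ U))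
    (hs : IsSamplingSol C U f K π z x u T) (j : ℕ)
    (hKU : K (x (π.t j)) ∈ U) {t : ℝ} (ht : t ∈ Set.Icc (π.t j) (π.t (j+1)))
    (hT : ENNReal.ofReal t < T) {c : ℝ}
    (hc : ∀ s ∈ Set.Icc (π.t j) t, l (x s) (K (x (π.t j))) ≤ c) :
    IntervalIntegrable (fun s => l (x s) (u s)) volume (π.t j) t ∧
    ∫ s in (π.t j)..t, l (x s) (u s) ≤ c * (t - π.t j) := by
  set a := π.t j with ha
  set v := K (x a) with hv
  have ha0 : 0 ≤ a := pi_nonneg π j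
  have hcont : ContinuousOn x (Set.Icc a t) :=
    hs.cont.mono (fun s h => ha0.trans h.1)
  have hfc : ContinuousOn (fun s => l (x s) v) (Set.Icc a t) := by
    intro s h
    have h1 : ContinuousAt (fun y => l y v) (x s) :=
      contAt_of_unif hC hl hKU (hs.outside s (ha0.trans h.1) (sol_before hs h.2 hT))
    exact h1.comp_continuousWithinAt (hcont s h)
  have hInt : IntervalIntegrable (fun s => l (x s) v) volume a t :=
    hfc.intervalIntegrable_of_Icc ht.1
  have heq : ∀ s ∈ Set.Ioo a t, l (x s) (u s) = l (x s) v := by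
    intro s h
    rw [hs.ctrl j s ⟨h.1.le, h.2.trans_le ht.2⟩]
  refine ⟨?_, ?_⟩
  · rw [intervalIntegrable_iff_integrableOn_Ioo_of_le ht.1] at hInt ⊢
    exact hInt.congr_fun (fun s h => (heq s h).symm) measurableSet_Ioo
  · rw [intervalIntegral.integral_congr_Ioo_of_le ht.1 heq]
    have : ∫ s in a..t, l (x s) v ≤ ∫ s in a..t, c :=
      intervalIntegral.integral_mono_on ht.1 hInt (by simp) hc
    simpa [mul_comm] using this

end traj

/-! ### One-step estimates -/

section steps

variable {n m : ℕ} {C : Set (Euc n)} {U : Set (Euc m)} {f : Euc n → Euc m → Euc n}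
  {l : Euc n → Euc m → ℝ} {p0 : ℝ} {W : Euc n → ℝ} {γ N : ℝ → ℝ} {psel : Euc n → Euc n}
  {K : Euc n → Euc m}

lemma feedback_dec
    (hNdec : ∀ x, x ∉ C → ∀ p ∈ limitingGradients W x,
      HamN U f l (N (W x)) p0 x p < -γ (W x))
    (hpsel : ∀ x, x ∉ C → psel x ∈ limitingGradients W x)
    (hK : IsWFeedback C U f l p0 W N psel K) {x : Euc n} (hx : x ∉ C) :
    ⟪psel x, f x (K x)⟫ + p0 * l x (K x) ≤ -γ (W x) := by
  have h1 := hNdec x hx _ (hpsel x hx)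
  unfold HamN at h1
  obtain ⟨_, ⟨v, hv, rfl⟩, h2⟩ := exists_lt_of_csInf_lt (Set.Nonempty.image _ ⟨K x, (hK x hx).1⟩) h1
  exact ((hK x hx).2 v hv).trans h2.le

lemma step_dec
    (hne : C.Nonempty)
    (hH0 : HypH0 C U f l) (hp0 : 0 ≤ p0) (hW : IsMRF C U f l p0 W γ)
    (hNdec : ∀ x, x ∉ C → ∀ p ∈ limitingGradients W x,
      HamN U f l (N (W x)) p0 x p < -γ (W x))
    (hpsel : ∀ x, x ∉ C → psel x ∈ limitingGradients W x)
    (hK : IsWFeedback C U f l p0 W N psel K) (w1 w2 : ℝ) (hw1 : 0 < w1) (hw2 : 0 < w2) :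
    ∃ δ > 0, ∀ π z x u T, IsSamplingSol C U f K π z x u T → ∀ j : ℕ,
      ENNReal.ofReal (π.t j) < T → π.t (j+1) - π.t j ≤ δ →
      w1 ≤ W (x (π.t j)) → W (x (π.t j)) ≤ w2 →
      ∀ t ∈ Set.Icc (π.t j) (π.t (j+1)), ENNReal.ofReal t < T ∧
        IntervalIntegrable (fun s => l (x s) (u s)) volume (π.t j) t ∧
        W (x t) + p0 * ∫ s in (π.t j)..t, l (x s) (u s) ≤
          W (x (π.t j)) - γ (W (x (π.t j))) / 2 * (t - π.t j) := by
  obtain ⟨hC, hfr, hU, hlnn, hunif, hbd⟩ := hH0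
  obtain ⟨hWc, hWnn, hsc, hpd, hP, ⟨hγc, hγm, hγp⟩, hHam⟩ := hW
  have hS0c : IsCompact (closure Cᶜ ∩ W ⁻¹' Set.Icc w1 w2) :=
    hP _ isCompact_Icc (fun w h => hw1.le.trans h.1)
  set S0 := closure Cᶜ ∩ W ⁻¹' Set.Icc w1 w2 with hS0
  have hS0C : S0 ⊆ Cᶜ := by
    intro y hy hyC
    have h1 := hpd.2 y (mem_frontier_of hy.1 hyC)
    have h2 : w1 ≤ W y := hy.2.1
    linarith
  obtain ⟨η, hη, hS1C⟩ := hS0c.exists_cthickening_subset_open hC.isOpen_compl hS0C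
  set S1 := cthickening η S0 with hS1
  have hS1c : IsCompact S1 := hS0c.cthickening
  have hballS1 : ∀ y ∈ S0, closedBall y η ⊆ S1 := fun y hy =>
    Metric.closedBall_subset_cthickening hy η
  obtain ⟨ρ, hρ, hρsc⟩ := hsc S1 hS1c hS1C
  obtain ⟨D, hD, hDb⟩ := d_bdd hWnn hP w2
  obtain ⟨M0, hM0, hMb⟩ := hbd (D + η) (by positivity)
  have hWat : ∀ y, y ∉ C → ContinuousAt W y := fun y hy =>
    hWc.continuousAt (mem_of_superset (hC.isOpen_compl.mem_nhds hy) subset_closure)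
  have hineq : ∀ y ∈ S0, ∀ p ∈ limitingGradients W y, ∀ y', ‖y' - y‖ ≤ η →
      W y' - W y ≤ ⟪p, y' - y⟫ + 2 * ρ * ‖y' - y‖ ^ 2 := fun y hy p hp y' hy' =>
    semiconc_lim hρsc hη (hballS1 y hy) (hWat y (hS0C hy)) hp hy'
  set P := (w2 + 2 * ρ * η ^ 2) / η with hPdef
  have hPpos : 0 < P := by positivity
  have hPb : ∀ y ∈ S0, ∀ p ∈ limitingGradients W y, ‖p‖ ≤ P := by
    intro y hy p hp
    rcases eq_or_ne p 0 with h0 | h0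
    · rw [h0, norm_zero]; exact hPpos.le
    have hpn : 0 < ‖p‖ := norm_pos_iff.2 h0
    have hnorm : ‖(y - (η / ‖p‖) • p) - y‖ = η := by
      rw [sub_sub_cancel_left, norm_neg, norm_smul, Real.norm_of_nonneg (by positivity)]
      field_simp
    have h1 := hineq y hy p hp (y - (η / ‖p‖) • p) hnorm.le
    have h2 : 0 ≤ W (y - (η / ‖p‖) • p) := by
      apply hWnn
      apply subset_closure
      apply hS1C
      apply hballS1 y hy
      rw [mem_closedBall, dist_eq_norm, hnorm]
    rw [hnorm] at h1
    have h3 : ⟪p, (y - (η / ‖p‖) • p) - y⟫ = - (η * ‖p‖) := by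
      rw [sub_sub_cancel_left, inner_neg_right, real_inner_smul_right, real_inner_self_eq_norm_sq]
      field_simp
    rw [h3] at h1
    have h4 : W y ≤ w2 := hy.2.2
    rw [hPdef, le_div_iff₀ hη]
    linarith
  have hγ1 := hγp w1 hw1
  set g := γ w1 with hg
  set ε := g / (4 * (P + p0 + 1)) with hε
  have hεpos : 0 < ε := by positivity
  have hεb : (P + p0) * ε ≤ g / 4 := by
    rw [hε, mul_div_assoc', div_le_div_iff₀ (by positivity) (by norm_num)]
    nlinarith
  obtain ⟨hfu, hlu⟩ := hunif S1 hS1c hS1C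
  obtain ⟨θ1, hθ1, hfθ⟩ := Metric.uniformContinuousOn_iff.1 hfu ε hεpos
  obtain ⟨θ2, hθ2, hlθ⟩ := Metric.uniformContinuousOn_iff.1 hlu ε hεpos
  set M := M0 + 1 with hMdef
  have hM : 0 < M := by positivity
  set θ := min θ1 θ2 with hθ
  have hθp : 0 < θ := lt_min hθ1 hθ2
  refine ⟨min (min (η / M) (θ / (2 * M))) (g / (8 * ρ * M ^ 2)), by positivity, ?_⟩
  intro π z x u T hs j hTj hδ hWl hWu t ht
  set a := π.t j with ha
  have ha0 : 0 ≤ a := pi_nonneg π j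
  have haC : x a ∉ C := hs.outside a ha0 hTj
  have hxS0 : x a ∈ S0 := ⟨subset_closure haC, hWl, hWu⟩
  have hKU : K (x a) ∈ U := (hK _ haC).1.1
  set v := K (x a) with hv
  have hδ1 : M * (π.t (j+1) - a) ≤ η := by
    have := hδ.trans ((min_le_left _ _).trans (min_le_left _ _))
    rw [le_div_iff₀ hM] at this
    linarith
  have hδ2 : M * (π.t (j+1) - a) ≤ θ / 2 := by
    have := hδ.trans ((min_le_left _ _).trans (min_le_right _ _))
    rw [le_div_iff₀ (by positivity)] at this
    linarith
  have hδ3 : 2 * ρ * M ^ 2 * (π.t (j+1) - a) ≤ g / 4 := by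
    have := hδ.trans (min_le_right _ _)
    rw [le_div_iff₀ (by positivity)] at this
    linarith
  have hin : ∀ s, ‖x s - x a‖ ≤ η → x s ∈ S1 := by
    intro s h
    apply hballS1 _ hxS0
    rwa [mem_closedBall, dist_eq_norm]
  have hspeed := sol_speed hC (fun Kc h1 h2 => (hunif Kc h1 h2).1) hs j hTj hKU hM hδ1 (by
    intro s _ _ h
    have h1 := hin s h
    have h2 : dC C (x s) ≤ D + η := by
      have h3 : dC C (x s) ≤ dC C (x a) + dist (x s) (x a) := Metric.infDist_le_infDist_add_dist
      rw [dist_eq_norm] at h3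
      have h4 := hDb (x a) hxS0.1 hWu
      linarith
    have := (hMb (x s) v h2 (hS1C h1) hKU).1
    linarith)
  have hsp : ∀ s ∈ Set.Icc a (π.t (j+1)), ‖x s - x a‖ ≤ M * (π.t (j+1) - a) := by
    intro s h
    refine (hspeed s h).trans ?_
    have := h.2
    gcongr
  have hS1s : ∀ s ∈ Set.Icc a (π.t (j+1)), x s ∈ S1 := fun s h =>
    hin s ((hsp s h).trans hδ1)
  have hT : ENNReal.ofReal t < T := by
    by_contra hcon
    have h1 := sol_after hs (not_lt.1 hcon)
    exact hS1C (hS1s t ht) (mem_of_dC_eq_zero hC hne h1)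
  have hclose : ∀ s ∈ Set.Icc a t, dist ((x s, v) : Euc n × Euc m) (x a, v) < θ := by
    intro s h
    have h1 := hsp s ⟨h.1, h.2.trans ht.2⟩
    rw [Prod.dist_eq, dist_self, max_eq_left dist_nonneg, dist_eq_norm]
    linarith
  have haS1 : x a ∈ S1 := hS1s a ⟨le_rfl, ht.1.trans ht.2⟩
  have hftc := sol_ftc hC (fun Kc h1 h2 => (hunif Kc h1 h2).1) hs j hKU ht hT (ε := ε)
    (f (x a) v) (by
      intro s h
      have := hfθ (x s, v) ⟨hS1s s ⟨h.1, h.2.trans ht.2⟩, hKU⟩ (x a, v) ⟨haS1, hKU⟩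
        ((hclose s h).trans_le (min_le_left _ _))
      rw [dist_eq_norm] at this
      exact this.le)
  obtain ⟨hInt, hcost⟩ := sol_cost hC (fun Kc h1 h2 => (hunif Kc h1 h2).2) hs j hKU ht hT
    (c := l (x a) v + ε) (by
      intro s h
      have := hlθ (x s, v) ⟨hS1s s ⟨h.1, h.2.trans ht.2⟩, hKU⟩ (x a, v) ⟨haS1, hKU⟩
        ((hclose s h).trans_le (min_le_right _ _))
      rw [Real.dist_eq] at this
      have := (abs_lt.1 this).2
      simp only at this
      linarith)
  refine ⟨hT, hInt, ?_⟩
  have hp := hpsel (x a) haC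
  set p := psel (x a) with hpdef
  have hdec : ⟪p, f (x a) v⟫ + p0 * l (x a) v ≤ -γ (W (x a)) := feedback_dec hNdec hpsel hK haC
  have hWineq := hineq (x a) hxS0 p hp (x t) ((hsp t ht).trans hδ1)
  have hτ : 0 ≤ t - a := by linarith [ht.1]
  set F := f (x a) v with hF
  have hinner : ⟪p, x t - x a⟫ ≤ (t - a) * ⟪p, F⟫ + P * ε * (t - a) := by
    have h1 : ⟪p, x t - x a⟫ = (t - a) * ⟪p, F⟫ + ⟪p, x t - x a - (t - a) • F⟫ := by
      rw [inner_sub_right p (x t - x a), real_inner_smul_right]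
      ring
    have h2 := real_inner_le_norm p (x t - x a - (t - a) • F)
    have h3 : ‖p‖ * ‖x t - x a - (t - a) • F‖ ≤ P * (ε * (t - a)) :=
      mul_le_mul (hPb _ hxS0 p hp) hftc (norm_nonneg _) hPpos.le
    rw [h1]
    linarith
  have hsq : 2 * ρ * ‖x t - x a‖ ^ 2 ≤ g / 4 * (t - a) := by
    have h1 : ‖x t - x a‖ ^ 2 ≤ (M * (t - a)) ^ 2 :=
      pow_le_pow_left₀ (norm_nonneg _) (hspeed t ht) 2
    have h2 : 2 * ρ * ‖x t - x a‖ ^ 2 ≤ 2 * ρ * (M * (t - a)) ^ 2 := by gcongr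
    have h3 : 2 * ρ * M ^ 2 * (t - a) ≤ g / 4 := by
      refine le_trans ?_ hδ3
      have := ht.2
      gcongr
    have h4 := mul_le_mul_of_nonneg_right h3 hτ
    refine h2.trans (le_trans (le_of_eq ?_) h4)
    ring
  have hcost' := mul_le_mul_of_nonneg_left hcost hp0
  have hγle : g ≤ γ (W (x a)) := hγm.monotoneOn hw1 (hw1.trans_le hWl) hWl
  have hdec' := mul_le_mul_of_nonneg_left hdec hτ
  have hεb' := mul_le_mul_of_nonneg_right hεb hτ
  have hγle' := mul_le_mul_of_nonneg_right hγle hτ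
  nlinarith

lemma step_near
    (hne : C.Nonempty)
    (hH0 : HypH0 C U f l) (hW : IsMRF C U f l p0 W γ)
    (hK : IsWFeedback C U f l p0 W N psel K) (w1 : ℝ) (hw1 : 0 < w1) :
    ∃ δ > 0, ∀ π z x u T, IsSamplingSol C U f K π z x u T → ∀ j : ℕ,
      ENNReal.ofReal (π.t j) < T → π.t (j+1) - π.t j ≤ δ →
      W (x (π.t j)) ≤ w1 →
      ∀ t ∈ Set.Icc (π.t j) (π.t (j+1)), W (x t) ≤ 2 * w1 := by
  obtain ⟨hC, hfr, hU, hlnn, hunif, hbd⟩ := hH0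
  obtain ⟨hWc, hWnn, hsc, hpd, hP, ⟨hγc, hγm, hγp⟩, hHam⟩ := hW
  obtain ⟨D, hD, hDb⟩ := d_bdd hWnn hP w1
  obtain ⟨M0, hM0, hMb⟩ := hbd (D + 1) (by positivity)
  set M := M0 + 1 with hMdef
  have hM : 0 < M := by positivity
  have hA := isCompact_AR hne hfr (D + 1)
  have huc := hA.uniformContinuousOn_of_continuous (hWc.mono Set.inter_subset_left)
  obtain ⟨θ, hθ, hWθ⟩ := Metric.uniformContinuousOn_iff.1 huc w1 hw1
  refine ⟨min (1 / M) (θ / (2 * M)), by positivity, ?_⟩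
  intro π z x u T hs j hTj hδ hWu t ht
  set a := π.t j with ha
  have ha0 : 0 ≤ a := pi_nonneg π j
  have haC : x a ∉ C := hs.outside a ha0 hTj
  have hKU : K (x a) ∈ U := (hK _ haC).1.1
  have hδ1 : M * (π.t (j+1) - a) ≤ 1 := by
    have := hδ.trans (min_le_left _ _)
    rw [le_div_iff₀ hM] at this
    linarith
  have hδ2 : M * (π.t (j+1) - a) ≤ θ / 2 := by
    have := hδ.trans (min_le_right _ _)
    rw [le_div_iff₀ (by positivity)] at this
    linarith
  have hda := hDb (x a) (subset_closure haC) hWu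
  have hd : ∀ s, ‖x s - x a‖ ≤ 1 → dC C (x s) ≤ D + 1 := by
    intro s h
    have h3 : dC C (x s) ≤ dC C (x a) + dist (x s) (x a) := Metric.infDist_le_infDist_add_dist
    rw [dist_eq_norm] at h3
    linarith
  have hspeed := sol_speed hC (fun Kc h1 h2 => (hunif Kc h1 h2).1) hs j hTj hKU hM hδ1 (by
    intro s h0 hTs h
    have := (hMb (x s) _ (hd s h) (hs.outside s (ha0.trans h0) hTs) hKU).1
    linarith)
  have hsp : ‖x t - x a‖ ≤ M * (π.t (j+1) - a) := by
    refine (hspeed t ht).trans ?_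
    have := ht.2
    gcongr
  have h1 := hWθ (x t) ⟨sol_closure hs (ha0.trans ht.1), hd t (hsp.trans hδ1)⟩
    (x a) ⟨subset_closure haC, by show dC C (x a) ≤ D + 1; linarith⟩ (by
      rw [dist_eq_norm]
      linarith)
  rw [Real.dist_eq] at h1
  have := (abs_lt.1 h1).2
  linarith

/-- The basic sample-stability property: all sampled trajectories with sampling time at most `δ`
decrease `W` until a time `T1`, and stay `ρ`-close to the target afterwards. -/
def GoodStep (C : Set (Euc n)) (U : Set (Euc m)) (f : Euc n → Euc m → Euc n)
    (l : Euc n → Euc m → ℝ) (p0 : ℝ) (W : Euc n → ℝ) (γ : ℝ → ℝ) (K : Euc n → Euc m)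
    (R δ ρ : ℝ) : Prop :=
  ∀ π : TimePartition, (∀ j, π.t (j+1) - π.t j ≤ δ) →
    ∀ z, z ∉ C → dC C z ≤ R → ∀ x u T, IsSamplingSol C U f K π z x u T →
      ∃ T1, 0 ≤ T1 ∧
        (∀ t, 0 ≤ t → t < T1 → x t ∉ C ∧ W (x t) + γ (W (x t)) / 2 * t ≤ W z) ∧
        (∀ t, T1 ≤ t → dC C (x t) ≤ ρ) ∧
        (∀ t, 0 ≤ t → t < T1 → 0 ≤ l (x t) (u t)) ∧
        IntervalIntegrable (fun s => l (x s) (u s)) volume 0 T1 ∧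
        p0 * ∫ s in (0:ℝ)..T1, l (x s) (u s) ≤ W z

lemma exists_goodStep
    (hne : C.Nonempty)
    (hH0 : HypH0 C U f l) (hp0 : 0 ≤ p0) (hW : IsMRF C U f l p0 W γ)
    (hNdec : ∀ x, x ∉ C → ∀ p ∈ limitingGradients W x,
      HamN U f l (N (W x)) p0 x p < -γ (W x))
    (hpsel : ∀ x, x ∉ C → psel x ∈ limitingGradients W x)
    (hK : IsWFeedback C U f l p0 W N psel K) (R ρ : ℝ) (hρ : 0 < ρ) :
    ∃ δ > 0, GoodStep C U f l p0 W γ K R δ ρ := by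
  have hH0' := hH0
  have hW' := hW
  obtain ⟨hC, hfr, hU, hlnn, hunif, hbd⟩ := hH0'
  obtain ⟨hWc, hWnn, hsc, hpd, hP, ⟨hγc, hγm, hγp⟩, hHam⟩ := hW'
  obtain ⟨w2, hw2, hw2b⟩ := W_bdd hne hfr hWc R
  obtain ⟨w0, hw0, hw0b⟩ := d_small hWc hWnn hpd hP ρ hρ
  set w1 := w0 / 2 with hw1def
  have hw1 : 0 < w1 := by positivity
  obtain ⟨δ1, hδ1, hS⟩ := step_dec hne hH0 hp0 hW hNdec hpsel hK w1 (max w2 w0) hw1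
    (lt_max_of_lt_left hw2)
  obtain ⟨δ2, hδ2, hNear⟩ := step_near hne hH0 hW hK w1 hw1
  refine ⟨min δ1 δ2, lt_min hδ1 hδ2, ?_⟩
  intro π hπ z hz hzR x u T hs
  have hγ1 := hγp w1 hw1
  have hWz : W z ≤ w2 := hw2b z (subset_closure hz) hzR
  have hWpos : ∀ t, 0 ≤ t → ENNReal.ofReal t < T → 0 < W (x t) := fun t h1 h2 =>
    hpd.1 _ (hs.outside t h1 h2)
  have hmonoW : ∀ y y', 0 < y → y ≤ y' → γ y ≤ γ y' := fun y y' h1 h2 =>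
    hγm.monotoneOn h1 (h1.trans_le h2) h2
  -- decrease while above the level `w1`
  have hphase : ∀ j, (∀ i < j, w1 ≤ W (x (π.t i))) →
      ENNReal.ofReal (π.t j) < T ∧
      W (x (π.t j)) + γ (W (x (π.t j))) / 2 * π.t j ≤ W z ∧
      IntervalIntegrable (fun s => l (x s) (u s)) volume 0 (π.t j) ∧
      W (x (π.t j)) + p0 * ∫ s in (0:ℝ)..(π.t j), l (x s) (u s) ≤ W z := by
    intro j
    induction j with
    | zero =>
      intro _
      rw [π.zero, hs.init]
      refine ⟨?_, ?_, ?_, ?_⟩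
      · simpa using hs.pos
      · simp
      · simp
      · simp
    | succ j ih =>
      intro hlev
      obtain ⟨hTj, hdec, hInt, hcost⟩ := ih (fun i hi => hlev i (by omega))
      have htj := pi_nonneg π j
      have hlt := π.mono (Nat.lt_succ_self j)
      have hWj := hWpos _ htj hTj
      have hγj := hγp _ hWj
      have hWle : W (x (π.t j)) ≤ W z := by
        have : 0 ≤ γ (W (x (π.t j))) / 2 * π.t j := by positivity
        linarith
      obtain ⟨h1, h2, h3⟩ := hS π z x u T hs j hTj ((hπ j).trans (min_le_left _ _))
        (hlev j (Nat.lt_succ_self j)) ((hWle.trans hWz).trans (le_max_left _ _))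
        (π.t (j+1)) ⟨hlt.le, le_rfl⟩
      have htj1 := pi_nonneg π (j+1)
      have hWj1 := hWpos _ htj1 h1
      have hlnn' : 0 ≤ ∫ s in (π.t j)..(π.t (j+1)), l (x s) (u s) := by
        rw [intervalIntegral.integral_congr_Ioo_of_le hlt.le
          (g := fun s => l (x s) (K (x (π.t j)))) (fun s h => by
            simp only
            rw [hs.ctrl j s ⟨h.1.le, h.2⟩])]
        exact intervalIntegral.integral_nonneg hlt.le
          (fun s _ => hlnn _ _ (hK _ (hs.outside _ htj hTj)).1.1)
      have hpl : 0 ≤ p0 * ∫ s in (π.t j)..(π.t (j+1)), l (x s) (u s) := mul_nonneg hp0 hlnn'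
      have hd0 : 0 ≤ γ (W (x (π.t j))) / 2 * (π.t (j+1) - π.t j) :=
        mul_nonneg (by positivity) (by linarith)
      have hγle := hmonoW (W (x (π.t (j+1)))) (W (x (π.t j))) hWj1 (by linarith)
      refine ⟨h1, ?_, hInt.trans h2, ?_⟩
      · have := mul_le_mul_of_nonneg_right hγle htj1
        linarith
      · rw [← intervalIntegral.integral_add_adjacent_intervals hInt h2, mul_add]
        linarith
  -- existence of a sampling time below the level
  have hexJ : ∃ j, W (x (π.t j)) < w1 := by
    by_contra hcon
    push Not at hcon
    obtain ⟨j, hj⟩ := (π.unbounded.eventually (eventually_gt_atTop (2 * W z / γ w1))).exists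
    obtain ⟨hTj, hdec, -, -⟩ := hphase j (fun i _ => hcon i)
    have h1 := hmonoW w1 _ hw1 (hcon j)
    have h2 := mul_le_mul_of_nonneg_right h1 (pi_nonneg π j)
    have h3 := hWpos _ (pi_nonneg π j) hTj
    rw [div_lt_iff₀ hγ1] at hj
    linarith
  classical
  set J := Nat.find hexJ with hJ
  have hJs : W (x (π.t J)) < w1 := Nat.find_spec hexJ
  have hJm : ∀ i < J, w1 ≤ W (x (π.t i)) := fun i hi => not_lt.1 (Nat.find_min hexJ hi)
  obtain ⟨hTJ, -, hintJ, hcostJ⟩ := hphase J hJm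
  -- a step inside the phase
  have hstep : ∀ t, 0 ≤ t → t < π.t J → ∃ j, j < J ∧ π.t j ≤ t ∧ t < π.t (j+1) := by
    intro t h1 h2
    obtain ⟨j, h3, h4⟩ := pi_interval π t h1
    exact ⟨j, π.mono.lt_iff_lt.1 (lt_of_le_of_lt h3 h2), h3, h4⟩
  -- the terminal phase
  have hafterW : ∀ t, 0 ≤ t → T ≤ ENNReal.ofReal t → W (x t) = 0 := by
    intro t h1 h2
    exact hpd.2 _ (mem_frontier_of (sol_closure hs h1)
      (mem_of_dC_eq_zero hC hne (sol_after hs h2)))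
  have hterm1 : ∀ j, W (x (π.t j)) ≤ w0 → ∀ t ∈ Set.Icc (π.t j) (π.t (j+1)), W (x t) ≤ w0 := by
    intro j hj t ht
    have htj := pi_nonneg π j
    by_cases hTj : ENNReal.ofReal (π.t j) < T
    · by_cases hlev : w1 ≤ W (x (π.t j))
      · obtain ⟨h1, h2, h3⟩ := hS π z x u T hs j hTj ((hπ j).trans (min_le_left _ _))
          hlev (hj.trans (le_max_right _ _)) t ht
        have hγj := hγp _ (hWpos _ htj hTj)
        have hlnn' : 0 ≤ ∫ s in (π.t j)..t, l (x s) (u s) := by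
          rw [intervalIntegral.integral_congr_Ioo_of_le ht.1
            (g := fun s => l (x s) (K (x (π.t j)))) (fun s h => by
              simp only
              rw [hs.ctrl j s ⟨h.1.le, h.2.trans_le ht.2⟩])]
          exact intervalIntegral.integral_nonneg ht.1
            (fun s _ => hlnn _ _ (hK _ (hs.outside _ htj hTj)).1.1)
        have hpl := mul_nonneg hp0 hlnn'
        have hd0 : 0 ≤ γ (W (x (π.t j))) / 2 * (t - π.t j) :=
          mul_nonneg (by positivity) (by linarith [ht.1])
        linarith
      · have := hNear π z x u T hs j hTj ((hπ j).trans (min_le_right _ _)) (not_le.1 hlev).le t ht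
        linarith
    · rw [hafterW t (htj.trans ht.1) ((not_lt.1 hTj).trans (ENNReal.ofReal_le_ofReal ht.1))]
      exact hw0.le
  have hterm2 : ∀ j, J ≤ j → W (x (π.t j)) ≤ w0 := by
    intro j hj
    induction j, hj using Nat.le_induction with
    | base => linarith
    | succ j _ ih =>
      exact hterm1 j ih _ ⟨(π.mono (Nat.lt_succ_self j)).le, le_rfl⟩
  refine ⟨π.t J, pi_nonneg π J, ?_, ?_, ?_, hintJ, ?_⟩
  · intro t ht0 ht
    obtain ⟨j, hjJ, hj1, hj2⟩ := hstep t ht0 ht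
    obtain ⟨hTj, hdec, -, -⟩ := hphase j (fun i hi => hJm i (hi.trans hjJ))
    have htj := pi_nonneg π j
    have hγj := hγp _ (hWpos _ htj hTj)
    have hWle : W (x (π.t j)) ≤ W z := by
      have : 0 ≤ γ (W (x (π.t j))) / 2 * π.t j := by positivity
      linarith
    obtain ⟨h1, h2, h3⟩ := hS π z x u T hs j hTj ((hπ j).trans (min_le_left _ _))
      (hJm j hjJ) ((hWle.trans hWz).trans (le_max_left _ _)) t ⟨hj1, hj2.le⟩
    refine ⟨hs.outside t ht0 h1, ?_⟩
    have hlnn' : 0 ≤ ∫ s in (π.t j)..t, l (x s) (u s) := by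
      rw [intervalIntegral.integral_congr_Ioo_of_le hj1
        (g := fun s => l (x s) (K (x (π.t j)))) (fun s h => by
          simp only
          rw [hs.ctrl j s ⟨h.1.le, h.2.trans hj2⟩])]
      exact intervalIntegral.integral_nonneg hj1
        (fun s _ => hlnn _ _ (hK _ (hs.outside _ htj hTj)).1.1)
    have hpl := mul_nonneg hp0 hlnn'
    have hd0 : 0 ≤ γ (W (x (π.t j))) / 2 * (t - π.t j) :=
      mul_nonneg (by positivity) (by linarith)
    have hγle := hmonoW (W (x t)) (W (x (π.t j))) (hWpos t ht0 h1) (by linarith)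
    have := mul_le_mul_of_nonneg_right hγle ht0
    linarith
  · intro t ht
    have ht0 := (pi_nonneg π J).trans ht
    obtain ⟨j, h1, h2⟩ := pi_interval π t ht0
    have hJj : J ≤ j := by
      have := π.mono.lt_iff_lt.1 (lt_of_le_of_lt ht h2)
      omega
    exact (hw0b _ (sol_closure hs ht0) (hterm1 j (hterm2 j hJj) t ⟨h1, h2.le⟩)).le
  · intro t ht0 ht
    obtain ⟨j, hjJ, hj1, hj2⟩ := hstep t ht0 ht
    obtain ⟨hTj, -, -, -⟩ := hphase j (fun i hi => hJm i (hi.trans hjJ))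
    rw [hs.ctrl j t ⟨hj1, hj2⟩]
    exact hlnn _ _ (hK _ (hs.outside _ (pi_nonneg π j) hTj)).1.1
  · have := hWpos _ (pi_nonneg π J) hTJ
    linarith

end steps


lemma exists_beta {n : ℕ} {C : Set (Euc n)} (hC : IsClosed C) (hne : C.Nonempty)
    (hfr : IsCompact (frontier C)) {W : Euc n → ℝ} (hWc : ContinuousOn W (closure Cᶜ))
    (hWnn : ∀ x ∈ closure Cᶜ, 0 ≤ W x) (hpd : PosDefOn C W) (hP : ProperOn C W)
    {γ : ℝ → ℝ} (hγ : RateFun γ) :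
    ∃ β : ℝ → ℝ → ℝ, IsKL β ∧ ∀ R t, 0 ≤ R → 0 ≤ t → ∀ y z, y ∉ C → z ∉ C → dC C z ≤ R →
      W y + γ (W y) / 2 * t ≤ W z → dC C y ≤ β R t := by
  obtain ⟨-, hγm, hγp⟩ := hγ
  set S : ℝ → ℝ → Set ℝ := fun R t => {d | ∃ y z, y ∉ C ∧ z ∉ C ∧ dC C z ≤ R ∧
    W y + γ (W y) / 2 * t ≤ W z ∧ d = dC C y} with hS
  have hcl : ∀ y, y ∉ C → y ∈ closure Cᶜ := fun y hy => subset_closure hy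
  have hWle : ∀ y z t, 0 ≤ t → y ∉ C → W y + γ (W y) / 2 * t ≤ W z → W y ≤ W z := by
    intro y z t ht hy h
    have h1 := hγp _ (hpd.1 y hy)
    have : 0 ≤ γ (W y) / 2 * t := by positivity
    linarith
  have hbdd : ∀ R t, 0 ≤ t → BddAbove (S R t) := by
    intro R t ht
    obtain ⟨w, hw, hwb⟩ := W_bdd hne hfr hWc R
    obtain ⟨D, hD, hDb⟩ := d_bdd hWnn hP w
    refine ⟨D, ?_⟩
    rintro d ⟨y, z, hy, hz, hzR, h, rfl⟩
    exact hDb y (hcl y hy) ((hWle y z t ht hy h).trans (hwb z (hcl z hz) hzR))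
  have hSnn : ∀ R t, ∀ d ∈ S R t, 0 ≤ d := by
    rintro R t d ⟨y, z, hy, hz, hzR, h, rfl⟩
    exact dC_nonneg C y
  have hnn : ∀ R t, 0 ≤ sSup (S R t) := fun R t => Real.sSup_nonneg (hSnn R t)
  suffices hex : ∃ β, IsKL β ∧ ∀ R t, 0 ≤ R → 0 ≤ t → sSup (S R t) ≤ β R t by
    obtain ⟨β, hβ, hle⟩ := hex
    refine ⟨β, hβ, fun R t hR ht y z hy hz hzR h => ?_⟩
    exact (le_csSup (hbdd R t ht) ⟨y, z, hy, hz, hzR, h, rfl⟩).trans (hle R t hR ht)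
  refine exists_KL_ge (fun R t => sSup (S R t)) hnn ?_ ?_ ?_ ?_
  · intro t ht R R' hRR
    refine Real.sSup_le ?_ (hnn _ _)
    rintro d ⟨y, z, hy, hz, hzR, h, rfl⟩
    exact le_csSup (hbdd R' t ht) ⟨y, z, hy, hz, hzR.trans hRR, h, rfl⟩
  · intro R t ht t' ht' htt
    refine Real.sSup_le ?_ (hnn _ _)
    rintro d ⟨y, z, hy, hz, hzR, h, rfl⟩
    refine le_csSup (hbdd R t ht) ⟨y, z, hy, hz, hzR, ?_, rfl⟩
    have h1 := hγp _ (hpd.1 y hy)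
    have : γ (W y) / 2 * t ≤ γ (W y) / 2 * t' := by gcongr
    linarith
  · intro R hR
    rw [Metric.tendsto_atTop]
    intro ε hε
    obtain ⟨w, hw, hwb⟩ := W_bdd hne hfr hWc R
    obtain ⟨w0, hw0, hw0b⟩ := d_small hWc hWnn hpd hP (ε/2) (by positivity)
    have hγ0 := hγp w0 hw0
    refine ⟨2 * w / γ w0, fun t ht => ?_⟩
    have ht0 : 0 ≤ t := le_trans (by positivity) ht
    rw [Real.dist_eq, sub_zero, abs_of_nonneg (hnn R t)]
    refine lt_of_le_of_lt (b := ε/2) (Real.sSup_le ?_ (by positivity)) (by linarith)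
    rintro d ⟨y, z, hy, hz, hzR, h, rfl⟩
    refine (hw0b y (hcl y hy) ?_).le
    by_contra hcon
    push Not at hcon
    have h1 := hγm (Set.mem_Ioi.2 hw0) (Set.mem_Ioi.2 (hw0.trans hcon)) hcon
    have h2 := hwb z (hcl z hz) hzR
    replace ht := (div_le_iff₀ hγ0).1 (show 2 * w / γ w0 ≤ t from ht)
    have h3 : γ w0 / 2 * t ≤ γ (W y) / 2 * t := by gcongr
    nlinarith
  · intro ε hε
    obtain ⟨w0, hw0, hw0b⟩ := d_small hWc hWnn hpd hP (ε/2) (by positivity)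
    obtain ⟨ρ, hρ, hρb⟩ := W_small hC hne hfr hWc hpd w0 hw0
    refine ⟨ρ, hρ, ?_⟩
    refine lt_of_le_of_lt (b := ε/2) (Real.sSup_le ?_ (by positivity)) (by linarith)
    rintro d ⟨y, z, hy, hz, hzR, h, rfl⟩
    exact (hw0b y (hcl y hy) ((hWle y z 0 le_rfl hy h).trans (hρb z (hcl z hz) hzR).le)).le

lemma Tbar_nonneg {n : ℕ} (C : Set (Euc n)) (x : ℝ → Euc n) (r : ℝ) : 0 ≤ Tbar C x r :=
  Real.sInf_nonneg fun _ h => h.1.le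

lemma Tbar_le {n : ℕ} {C : Set (Euc n)} {x : ℝ → Euc n} {r T1 : ℝ} (h0 : 0 ≤ T1)
    (h : ∀ t, T1 ≤ t → dC C (x t) ≤ r) : Tbar C x r ≤ T1 := by
  refine le_of_forall_pos_le_add fun ε hε => ?_
  refine csInf_le ⟨0, fun _ h => h.1.le⟩ ⟨by positivity, fun τ hτ => h τ (by linarith)⟩

lemma integral_le_of_le {g : ℝ → ℝ} {a T1 : ℝ} (ha : 0 ≤ a) (haT : a ≤ T1)
    (hg : IntervalIntegrable g volume 0 T1) (hnn : ∀ t, 0 ≤ t → t < T1 → 0 ≤ g t) :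
    ∫ s in (0:ℝ)..a, g s ≤ ∫ s in (0:ℝ)..T1, g s := by
  have i1 : IntervalIntegrable g volume 0 a := hg.mono_set (by
    rw [Set.uIcc_of_le ha, Set.uIcc_of_le (ha.trans haT)]; exact Set.Icc_subset_Icc_right haT)
  have i2 : IntervalIntegrable g volume a T1 := hg.mono_set (by
    rw [Set.uIcc_of_le haT, Set.uIcc_of_le (ha.trans haT)]; exact Set.Icc_subset_Icc_left ha)
  rw [← intervalIntegral.integral_add_adjacent_intervals i1 i2]
  have : 0 ≤ ∫ s in a..T1, g s := by
    rw [intervalIntegral.integral_of_le haT, MeasureTheory.integral_Ioc_eq_integral_Ioo]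
    exact MeasureTheory.setIntegral_nonneg measurableSet_Ioo
      fun s hs => hnn s (ha.trans hs.1.le) hs.2
  linarith

/-- Lemma 3.11: uniform sample stabilization with radius `r(δ)` depending on the
sampling time `δ`, together with the `(p₀,W)` cost bound. -/
theorem sample_stabilization_with_radius_depending_on_sampling_time
    {n m : ℕ} (C : Set (Euc n)) (U : Set (Euc m))
    (f : Euc n → Euc m → Euc n) (l : Euc n → Euc m → ℝ)
    (p0 : ℝ) (W : Euc n → ℝ) (γ : ℝ → ℝ) (N : ℝ → ℝ)
    (psel : Euc n → Euc n) (K : Euc n → Euc m)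
    (hH0 : HypH0 C U f l) (hp0 : 0 ≤ p0) (hW : IsMRF C U f l p0 W γ)
    (hN : ContinuousOn N (Set.Ioi 0)) (hNpos : ∀ r, 0 < r → 0 < N r)
    (hNdec : ∀ x, x ∉ C → ∀ p ∈ limitingGradients W x,
      HamN U f l (N (W x)) p0 x p < -γ (W x))
    (hpsel : ∀ x, x ∉ C → psel x ∈ limitingGradients W x)
    (hK : IsWFeedback C U f l p0 W N psel K) :
    ∃ β : ℝ → ℝ → ℝ, IsKL β ∧ ∀ R : ℝ, 0 < R → ∃ δR > (0:ℝ), ∃ r : ℝ → ℝ,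
      ContinuousOn r (Set.Icc 0 δR) ∧ StrictMonoOn r (Set.Icc 0 δR) ∧
      r 0 = 0 ∧ r δR = R ∧ (∀ δ ∈ Set.Icc (0:ℝ) δR, r δ ∈ Set.Icc (0:ℝ) R) ∧
      ∀ δ, 0 < δ → δ < δR →
        ∀ π : TimePartition, IsLUB (Set.range fun j => π.t (j+1) - π.t j) δ →
        ∀ z, z ∉ C → dC C z ≤ R →
        ∀ x u T, IsSamplingSol C U f K π z x u T →
          (∀ t, 0 ≤ t → dC C (x t) ≤ max (β R t) (r δ)) ∧
          (0 < p0 →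
            (∫ τ in (0:ℝ)..(Tbar C x (r δ)), l (x τ) (u τ)) ≤ W z / p0) := by
  obtain ⟨hC, hfr, -⟩ := id hH0
  obtain ⟨hWc, hWnn, hsc, hpd, hP, hγ, hHam⟩ := id hW
  rcases C.eq_empty_or_nonempty with rfl | hne
  · obtain ⟨β, hβ, -⟩ := exists_KL_ge (fun _ _ => 0) (fun _ _ => le_rfl)
      (fun _ _ _ _ _ => le_rfl) (fun _ _ _ _ _ _ => le_rfl) (fun _ _ => tendsto_const_nhds)
      (fun ε hε => ⟨1, one_pos, hε⟩)
    have hd : ∀ y : Euc n, dC ∅ y = 0 := fun y => Metric.infDist_empty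
    refine ⟨β, hβ, fun R hR => ?_⟩
    obtain ⟨δR, hδR, r, h1, h2, h3, h4, h5, -⟩ := exists_radius R hR (fun _ _ => True)
      (fun _ _ => ⟨1, one_pos, trivial⟩) (fun _ _ _ _ _ _ => trivial) (fun _ _ _ _ _ => trivial)
    refine ⟨δR, hδR, r, h1, h2, h3, h4, h5, fun δ hδ hδ' π hπ z hz hzR x u T hs => ?_⟩
    have hr := (h5 δ ⟨hδ.le, hδ'.le⟩).1
    refine ⟨fun t ht => ?_, fun hp => ?_⟩
    · rw [hd]
      exact le_max_of_le_right hr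
    · have hT : Tbar ∅ x (r δ) = 0 :=
        le_antisymm (Tbar_le le_rfl fun t _ => by rw [hd]; exact hr) (Tbar_nonneg _ _ _)
      rw [hT, intervalIntegral.integral_same]
      exact div_nonneg (hpd.1 z hz).le hp0
  · obtain ⟨β, hβ, hle⟩ := exists_beta hC hne hfr hWc hWnn hpd hP hγ
    refine ⟨β, hβ, fun R hR => ?_⟩
    obtain ⟨δR, hδR, r, h1, h2, h3, h4, h5, h6⟩ := exists_radius R hR
      (fun δ ρ => GoodStep C U f l p0 W γ K R δ ρ)
      (fun ρ hρ => exists_goodStep hne hH0 hp0 hW hNdec hpsel hK R ρ hρ)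
      (fun δ δ' ρ _ hδδ h π hπ => h π fun j => (hπ j).trans hδδ)
      (fun δ ρ ρ' hρρ h π hπ z hz hzR x u T hs => by
        obtain ⟨T1, a1, a2, a3, a4⟩ := h π hπ z hz hzR x u T hs
        exact ⟨T1, a1, a2, fun t ht => (a3 t ht).trans hρρ, a4⟩)
    refine ⟨δR, hδR, r, h1, h2, h3, h4, h5, fun δ hδ hδ' π hπ z hz hzR x u T hs => ?_⟩
    obtain ⟨T1, a1, a2, a3, a4, a5, a6⟩ := h6 δ hδ hδ' π (fun j => hπ.1 ⟨j, rfl⟩) z hz hzR x u T hs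
    refine ⟨fun t ht => ?_, fun hp => ?_⟩
    · rcases lt_or_ge t T1 with h | h
      · obtain ⟨b1, b2⟩ := a2 t ht h
        exact le_max_of_le_left (hle R t hR.le ht _ z b1 hz hzR b2)
      · exact le_max_of_le_right (a3 t h)
    · refine (integral_le_of_le (Tbar_nonneg _ _ _) (Tbar_le a1 a3) a5 a4).trans ?_
      rw [le_div_iff₀ hp, mul_comm]
      exact a6
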